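/- arXiv:1309.0479 — 5 statements merged into one kernel-verified Lean document; each statement's English description precedes it below -/
import Mathlib

section
/- For every positive integer n there exists a prime number p in the interval [n, 9(n+3)/8], i.e., there exists a prime p with n ≤ p and 8p ≤ 9(n+3). -/
/-! A Chebyshev-type argument: an explicit integer combination of the functions
`log ⌊M / e⌋!` isolates the primes in `(M / 9, M / 8]`, up to a small tail. -/

namespace Breusch

open Finset Chebyshev ArithmeticFunction

/-! ### Small values: a ladder of primes -/

/-- `q` is not divisible by any of `d, …, d + k - 1`. -/
def inner (q d : ℕ) : ℕ → Bool
  | 0 => true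
  | k + 1 => !(Nat.beq (q % (d + k)) 0) && inner q d k

/-- `q` is not divisible by any of `b, …, b * (k + 1) - 1`. -/
def outer (q b : ℕ) : ℕ → Bool
  | 0 => true
  | k + 1 => inner q (b * (k + 1)) b && outer q b k

/-- Trial division of `q` by all `d` with `2 ≤ d < b * b`, in blocks of length `b`. -/
def trial (q b : ℕ) : Bool :=
  Nat.blt q (b * b * (b * b)) && (inner q 2 (b - 2) && outer q b (b - 1))

theorem inner_sound (q d : ℕ) : ∀ k, inner q d k = true → ∀ m, d ≤ m → m < d + k → ¬ m ∣ q := by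
  intro k
  induction k with
  | zero => intro _ m h1 h2; omega
  | succ k ih =>
    intro h m h1 h2 hdvd
    rw [inner, Bool.and_eq_true] at h
    rcases Nat.lt_or_ge m (d + k) with h3 | h3
    · exact ih h.2 m h1 h3 hdvd
    · have h4 : m = d + k := by omega
      subst h4
      have h5 := h.1
      simp [Nat.mod_eq_zero_of_dvd hdvd] at h5

theorem outer_sound (q b : ℕ) : ∀ k, outer q b k = true →
    ∀ m, b ≤ m → m < b * (k + 1) → ¬ m ∣ q := by
  intro k
  induction k with
  | zero => intro _ m h1 h2; omega
  | succ k ih =>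
    intro h m h1 h2
    rw [outer, Bool.and_eq_true] at h
    rcases Nat.lt_or_ge m (b * (k + 1)) with h3 | h3
    · exact ih h.2 m h1 h3
    · exact inner_sound q _ b h.1 m h3 (by rw [Nat.mul_succ] at h2; exact h2)

theorem prime_of_trial {q b : ℕ} (h2 : 2 ≤ q) (h : trial q b = true) : q.Prime := by
  rw [trial, Bool.and_eq_true, Bool.and_eq_true] at h
  obtain ⟨h0, h1, h3⟩ := h
  have h0' : q < b * b * (b * b) := by simpa [Nat.blt_eq] using h0
  have hb : 0 < b := by
    rcases Nat.eq_zero_or_pos b with hb | hb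
    · subst hb; simp at h0'
    · exact hb
  rw [Nat.prime_def_le_sqrt]
  refine ⟨h2, fun m hm hms => ?_⟩
  have h4 : m * m ≤ q := Nat.le_sqrt.mp hms
  have h5 : m < b * b := Nat.mul_self_lt_mul_self_iff.mp (h4.trans_lt h0')
  rcases Nat.lt_or_ge m b with h6 | h6
  · exact inner_sound q 2 _ h1 m hm (by omega)
  · exact outer_sound q b _ h3 m h6 (by rwa [Nat.sub_add_cancel hb])

/-- Checks that consecutive entries are primes close enough to each other. -/
def chk : ℕ → List (ℕ × ℕ) → Bool
  | _, [] => true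
  | p, x :: l =>
    (Nat.ble 2 x.1 && trial x.1 x.2) && (Nat.ble (8 * x.1) (9 * (p + 4)) && chk x.1 l)

/-- The last prime of a ladder. -/
def top : ℕ → List (ℕ × ℕ) → ℕ
  | p, [] => p
  | _, x :: l => top x.1 l

theorem chk_sound : ∀ (l : List (ℕ × ℕ)) (p : ℕ), chk p l = true →
    (∀ n ≤ p, ∃ r : ℕ, r.Prime ∧ n ≤ r ∧ 8 * r ≤ 9 * (n + 3)) →
    ∀ n ≤ top p l, ∃ r : ℕ, r.Prime ∧ n ≤ r ∧ 8 * r ≤ 9 * (n + 3) := by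
  intro l
  induction l with
  | nil => intro p _ h n hn; exact h n hn
  | cons x l ih =>
    intro p h hp n hn
    rw [chk, Bool.and_eq_true, Bool.and_eq_true, Bool.and_eq_true, Nat.ble_eq, Nat.ble_eq] at h
    obtain ⟨⟨h1, h2⟩, h3, h4⟩ := h
    refine ih x.1 h4 ?_ n hn
    intro m hm
    by_cases hmp : m ≤ p
    · exact hp m hmp
    · exact ⟨x.1, prime_of_trial h1 h2, hm, by omega⟩

/-- The ladder of primes, each with the block length for trial division. -/
def ladder : List (ℕ × ℕ) :=
  [
   (5, 2), (7, 2), (11, 2), (13, 2), (19, 3), (23, 3), (29, 3), (37, 3), (43, 3), (47, 3),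
   (53, 3), (61, 3), (73, 3), (83, 4), (97, 4), (113, 4), (131, 4), (151, 4), (173, 4),
   (199, 4), (227, 4), (257, 5), (293, 5), (331, 5), (373, 5), (421, 5), (467, 5), (523, 5),
   (587, 5), (661, 6), (743, 6), (839, 6), (947, 6), (1069, 6), (1201, 6), (1327, 7),
   (1493, 7), (1669, 7), (1879, 7), (2113, 7), (2381, 7), (2683, 8), (3019, 8), (3391, 8),
   (3803, 8), (4273, 9), (4801, 9), (5399, 9), (6073, 9), (6833, 10), (7691, 10), (8647, 10),
   (9721, 10), (10939, 11), (12301, 11), (13841, 11), (15569, 12), (17519, 12), (19709, 12),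
   (22171, 13), (24943, 13), (28057, 13), (31567, 14), (35509, 14), (39937, 15), (44927, 15),
   (50543, 15), (56857, 16), (63949, 16), (71947, 17), (80933, 17), (91033, 18), (102409, 18),
   (115211, 19), (129607, 19), (145807, 20), (164023, 21), (184523, 21), (207589, 22),
   (233509, 22), (262697, 23), (295517, 24), (332461, 25), (374009, 25), (420757, 26),
   (473353, 27), (532523, 28), (599087, 28), (673961, 29), (758203, 30), (852959, 31),
   (959579, 32), (1079527, 33), (1214471, 34), (1366279, 35), (1537061, 36), (1729193, 37),
   (1945337, 38), (2188493, 39), (2462041, 40), (2769791, 41), (3116011, 43), (3505501, 44),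
   (3943691, 45), (4436647, 46), (4991201, 48), (5615101, 49), (6316969, 51), (7106591, 52),
   (7994897, 54), (8994233, 55), (10118503, 57), (11383313, 59), (12806203, 60),
   (14406961, 62), (16207787, 64), (18233731, 66), (20512949, 68), (23077063, 70),
   (25961693, 72), (29206909, 74), (32857771, 76)
  ]

theorem ladder_ok : chk 2 ladder = true := by decide +kernel

theorem ladder_last : top 2 ladder = 32857771 := by decide +kernel

theorem small_case (n : ℕ) (hn : n ≤ 30000000) :
    ∃ r : ℕ, r.Prime ∧ n ≤ r ∧ 8 * r ≤ 9 * (n + 3) := by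
  refine chk_sound ladder 2 ladder_ok ?_ n (by rw [ladder_last]; omega)
  intro m hm
  exact ⟨2, Nat.prime_two, hm, by omega⟩

/-! ### The Chebyshev-type weights -/

/-- Pairs `(e, A)`: the weight `A` of `log ⌊M / e⌋!`. -/
def coef : List (ℕ × ℤ) :=
  [(8, 2), (9, -2), (16, -2), (18, 2), (24, -2), (28, 2), (40, -2), (45, 2), (48, 2),
   (56, -4), (63, 2), (80, 2), (84, -2), (90, -2), (112, 2), (120, 2), (126, -2), (140, -2),
   (144, -2), (168, 4), (240, -2), (280, 4), (336, -2), (420, 4), (504, -1), (560, -1),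
   (630, 2), (840, -6), (1008, 4), (1680, 3), (2520, 2)]

/-- The step function attached to a list of weights. -/
def step (l : List (ℕ × ℤ)) (t : ℕ) : ℤ := (l.map fun x => x.2 * ((t / x.1 : ℕ) : ℤ)).sum

theorem step_fin_aux : ∀ i < 70, ∀ j < 72, step coef (72 * i + j) ≤
    if 72 * i + j = 8 then 2 else if 72 * i + j < 2216 then 0 else 2 := by
  decide +kernel

theorem step_fin (t : ℕ) (ht : t < 5040) : step coef t ≤
    if t = 8 then 2 else if t < 2216 then 0 else 2 := by
  have h := step_fin_aux (t / 72) (by omega) (t % 72) (Nat.mod_lt _ (by norm_num))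
  rwa [Nat.div_add_mod] at h

theorem step_period (l : List (ℕ × ℤ)) (hl : ∀ x ∈ l, x.1 ∣ 5040) (r q : ℕ) :
    step l (r + 5040 * q) = step l r + q * (l.map fun x => x.2 * ((5040 / x.1 : ℕ) : ℤ)).sum := by
  induction l with
  | nil => simp [step]
  | cons x l ih =>
    have ih' := ih fun y hy => hl y (List.mem_cons_of_mem _ hy)
    obtain ⟨c, hc⟩ := hl x List.mem_cons_self
    have hx : 0 < x.1 := Nat.pos_of_ne_zero fun h => by simp [h] at hc
    have h1 : (r + 5040 * q) / x.1 = r / x.1 + c * q := by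
      rw [hc, mul_assoc, Nat.add_mul_div_left _ _ hx]
    have h2 : 5040 / x.1 = c := by rw [hc, Nat.mul_div_cancel_left _ hx]
    simp only [step, List.map_cons, List.sum_cons] at ih' ⊢
    rw [ih', h1, h2]
    push_cast
    ring

theorem step_le (t : ℕ) : step coef t ≤
    (if t = 8 then 2 else 0) + (if 2216 ≤ t then 2 else 0) := by
  by_cases ht : t < 5040
  · have := step_fin t ht
    split_ifs at this ⊢ <;> omega
  · have h1 := step_period coef (by decide +kernel) (t % 5040) (t / 5040)
    have h0 : (coef.map fun x => x.2 * ((5040 / x.1 : ℕ) : ℤ)).sum = 0 := by decide +kernel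
    rw [Nat.mod_add_div, h0] at h1
    have h2 := step_fin (t % 5040) (Nat.mod_lt _ (by norm_num))
    rw [h1]
    split_ifs at h2 ⊢ <;> omega

/-! ### Factorials and the von Mangoldt function -/

theorem log_factorial_eq (N : ℕ) :
    Real.log (N.factorial) = ∑ m ∈ Ioc 0 N, vonMangoldt m * ((N / m : ℕ) : ℝ) := by
  rw [← sum_Ioc_mul_zeta_eq_sum, vonMangoldt_mul_zeta]
  induction N with
  | zero => simp
  | succ N ih =>
    rw [Nat.factorial_succ, Nat.cast_mul, Real.log_mul (by positivity) (by positivity), ih,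
      Finset.sum_Ioc_succ_top (Nat.zero_le N), add_comm, log_apply]

theorem log_factorial_div (M e : ℕ) :
    Real.log ((M / e).factorial) =
      ∑ m ∈ Ioc 0 M, vonMangoldt m * ((M / m / e : ℕ) : ℝ) := by
  rw [log_factorial_eq]
  have h : Ioc 0 (M / e) ⊆ Ioc 0 M := Ioc_subset_Ioc_right (Nat.div_le_self _ _)
  rw [← sum_subset h]
  · refine sum_congr rfl fun m _ => ?_
    rw [Nat.div_div_eq_div_mul, Nat.div_div_eq_div_mul, mul_comm e m]
  · intro m hm hm'
    simp only [mem_Ioc, not_and, not_le] at hm hm'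
    have : M / m / e = 0 := by
      rw [Nat.div_div_eq_div_mul, mul_comm, ← Nat.div_div_eq_div_mul]
      exact Nat.div_eq_of_lt (hm' hm.1)
    simp [this]

/-- The weighted sum of logarithms of factorials. -/
noncomputable def wsum (l : List (ℕ × ℤ)) (M : ℕ) : ℝ :=
  (l.map fun x => (x.2 : ℝ) * Real.log ((M / x.1).factorial)).sum

theorem wsum_eq (l : List (ℕ × ℤ)) (M : ℕ) :
    wsum l M = ∑ m ∈ Ioc 0 M, vonMangoldt m * (step l (M / m) : ℝ) := by
  induction l with
  | nil => simp [wsum, step]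
  | cons x l ih =>
    simp only [wsum, step, List.map_cons, List.sum_cons] at ih ⊢
    rw [ih, log_factorial_div, mul_sum, ← sum_add_distrib]
    refine sum_congr rfl fun m _ => ?_
    rw [Int.cast_add, Int.cast_mul, Int.cast_natCast]
    ring

theorem wsum_le (M : ℕ) (hM : ∀ p : ℕ, p.Prime → M / p ≠ 8) :
    wsum coef M ≤ 2 * (psi ((M / 8 : ℕ) : ℝ) - theta ((M / 8 : ℕ) : ℝ))
      + 2 * psi ((M / 2216 : ℕ) : ℝ) := by
  rw [wsum_eq, psi_sub_theta_eq_sum_not_prime, psi, Nat.floor_natCast, Nat.floor_natCast,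
    mul_sum, mul_sum]
  have h1 : ∀ m ∈ Ioc 0 M, vonMangoldt m * (step coef (M / m) : ℝ) ≤
      (if M / m = 8 then 2 * vonMangoldt m else 0)
        + (if 2216 ≤ M / m then 2 * vonMangoldt m else 0) := by
    intro m _
    have h2 : (step coef (M / m) : ℝ) ≤
        (if M / m = 8 then 2 else 0) + (if 2216 ≤ M / m then 2 else 0) := by
      exact_mod_cast step_le (M / m)
    have h3 := mul_le_mul_of_nonneg_left h2 (vonMangoldt_nonneg (n := m))
    refine h3.trans (le_of_eq ?_)
    split_ifs <;> ring
  refine (sum_le_sum h1).trans ?_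
  rw [sum_add_distrib, ← sum_filter, ← sum_filter]
  refine add_le_add ?_ ?_
  · refine sum_le_sum_of_subset_of_nonneg ?_ fun m _ _ =>
      mul_nonneg zero_le_two vonMangoldt_nonneg
    intro m hm
    simp only [mem_filter, mem_Ioc] at hm ⊢
    refine ⟨⟨hm.1.1, ?_⟩, fun hp => hM m hp hm.2⟩
    rw [Nat.le_div_iff_mul_le (by norm_num), ← hm.2]
    exact Nat.mul_div_le M m
  · refine sum_le_sum_of_subset_of_nonneg ?_ fun m _ _ =>
      mul_nonneg zero_le_two vonMangoldt_nonneg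
    intro m hm
    simp only [mem_filter, mem_Ioc] at hm ⊢
    refine ⟨hm.1.1, ?_⟩
    rw [Nat.le_div_iff_mul_le (by norm_num)]
    exact (Nat.mul_le_mul_left m hm.2).trans (Nat.mul_div_le M m)

/-! ### Stirling bounds -/

theorem log_factorial_upper (n : ℕ) (hn : 1 ≤ n) :
    Real.log n.factorial ≤ n * Real.log n - n + Real.log n + 1 := by
  induction n, hn using Nat.le_induction with
  | base => simp
  | succ n hn ih =>
    have hn0 : (0 : ℝ) < n := by exact_mod_cast hn
    rw [Nat.factorial_succ, Nat.cast_mul, Real.log_mul (by positivity) (by positivity)]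
    have h := Real.one_sub_inv_le_log_of_pos (show (0 : ℝ) < (n + 1) / n by positivity)
    rw [Real.log_div (by positivity) (by positivity), inv_div] at h
    have h2 : (n + 1 : ℝ) * (1 - n / (n + 1)) = 1 := by field_simp; ring
    have h3 := mul_le_mul_of_nonneg_left h (show (0 : ℝ) ≤ n + 1 by positivity)
    push_cast
    rw [h2] at h3
    linarith

theorem log_factorial_lower (n : ℕ) (hn : 1 ≤ n) :
    n * Real.log n - n ≤ Real.log n.factorial := by
  have h := Stirling.le_log_factorial_stirling (n := n) (by omega)
  have h1 : 0 ≤ Real.log n := Real.log_natCast_nonneg n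
  have h2 : 0 ≤ Real.log (2 * Real.pi) := Real.log_nonneg (by linarith [Real.pi_gt_three])
  linarith

theorem xlogx_mono {x y : ℝ} (hx : 1 ≤ x) (hxy : x ≤ y) :
    x * Real.log x - x ≤ y * Real.log y - y := by
  have hx0 : 0 < x := by linarith
  have hy0 : 0 < y := by linarith
  have h := Real.one_sub_inv_le_log_of_pos (show 0 < y / x by positivity)
  rw [Real.log_div hy0.ne' hx0.ne', inv_div] at h
  have h2 : y * (1 - x / y) = y - x := by field_simp
  have h3 := mul_le_mul_of_nonneg_left h hy0.le
  rw [h2] at h3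
  have h4 : 0 ≤ (y - x) * Real.log x := mul_nonneg (by linarith) (Real.log_nonneg hx)
  linarith

theorem stirling_div (M e : ℕ) (he : 1 ≤ e) (heM : e ≤ M) :
    |Real.log ((M / e).factorial)
      - (M : ℝ) * ((Real.log M - 1) * (1 / e) - Real.log e / e)| ≤ Real.log M + 1 := by
  set N := M / e with hN
  have he0 : (0 : ℝ) < e := by exact_mod_cast he
  have hM0 : (0 : ℝ) < M := by exact_mod_cast (he.trans heM)
  have hN1 : 1 ≤ N := (Nat.one_le_div_iff (by omega)).mpr heM
  have hN1' : (1 : ℝ) ≤ N := by exact_mod_cast hN1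
  have hNx : (N : ℝ) ≤ M / e := Nat.cast_div_le
  have hxN : (M : ℝ) / e ≤ (N : ℝ) + 1 := by
    rw [div_le_iff₀ he0]
    have := Nat.lt_mul_div_succ M (show 0 < e by omega)
    have h : M ≤ (N + 1) * e := by rw [mul_comm]; exact this.le
    exact_mod_cast h
  have heq : (M : ℝ) * ((Real.log M - 1) * (1 / e) - Real.log e / e)
      = (M / e) * Real.log (M / e) - M / e := by
    rw [Real.log_div hM0.ne' he0.ne']
    ring
  have hNM : (N : ℝ) ≤ M := by exact_mod_cast Nat.div_le_self M e
  have hlogN : Real.log N ≤ Real.log M := Real.log_le_log (by linarith) hNM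
  rw [heq, abs_le]
  constructor
  · have h1 := log_factorial_lower (N + 1) (by omega)
    rw [Nat.factorial_succ, Nat.cast_mul, Real.log_mul (by positivity) (by positivity)] at h1
    push_cast at h1
    have h2 := xlogx_mono (hN1'.trans hNx) hxN
    have h3 : Real.log ((N : ℝ) + 1) ≤ Real.log (2 * M) :=
      Real.log_le_log (by positivity) (by linarith)
    rw [Real.log_mul (by norm_num) hM0.ne'] at h3
    have := Real.log_two_lt_d9
    linarith
  · have h1 := log_factorial_upper N hN1
    have h2 := xlogx_mono hN1' hNx
    linarith

theorem wsum_ge (l : List (ℕ × ℤ)) (M : ℕ) (hl : ∀ x ∈ l, 1 ≤ x.1 ∧ x.1 ≤ M) :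
    (M : ℝ) * ((Real.log M - 1) * (l.map fun x => (x.2 : ℝ) * (1 / x.1)).sum
        - (l.map fun x => (x.2 : ℝ) * (Real.log x.1 / x.1)).sum)
      - (l.map fun x => |(x.2 : ℝ)|).sum * (Real.log M + 1) ≤ wsum l M := by
  induction l with
  | nil => simp [wsum]
  | cons x l ih =>
    have ih' := ih fun y hy => hl y (List.mem_cons_of_mem _ hy)
    obtain ⟨h1, h2⟩ := hl x List.mem_cons_self
    have h3 := stirling_div M x.1 h1 h2
    have h4 := mul_le_mul_of_nonneg_left h3 (abs_nonneg (x.2 : ℝ))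
    rw [← abs_mul] at h4
    have h5 := (abs_le.mp h4).1
    simp only [wsum, List.map_cons, List.sum_cons] at ih' ⊢
    linarith

/-! ### Numerics -/

theorem log_five_lt : Real.log 5 < 1.609445 := by
  have h : Real.log (15625 / 15552) ≤ 15625 / 15552 - 1 :=
    Real.log_le_sub_one_of_pos (by norm_num)
  rw [Real.log_div (by norm_num) (by norm_num),
    show (15625 : ℝ) = 5 ^ 6 by norm_num, show (15552 : ℝ) = 2 ^ 6 * 3 ^ 5 by norm_num,
    Real.log_mul (by norm_num) (by norm_num), Real.log_pow, Real.log_pow, Real.log_pow] at h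
  have := Real.log_two_lt_d9
  have := Real.log_three_lt_d9
  norm_num at h ⊢
  linarith

theorem log_seven_lt : Real.log 7 < 1.945920 := by
  have h : Real.log (2401 / 2400) ≤ 2401 / 2400 - 1 :=
    Real.log_le_sub_one_of_pos (by norm_num)
  rw [Real.log_div (by norm_num) (by norm_num),
    show (2401 : ℝ) = 7 ^ 4 by norm_num, show (2400 : ℝ) = 2 ^ 5 * 3 * 5 ^ 2 by norm_num,
    Real.log_mul (by norm_num) (by norm_num), Real.log_mul (by norm_num) (by norm_num),
    Real.log_pow, Real.log_pow, Real.log_pow] at h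
  have := Real.log_two_lt_d9
  have := Real.log_three_lt_d9
  have := log_five_lt
  norm_num at h this ⊢
  linarith

theorem coef_sum_inv : (coef.map fun x => (x.2 : ℝ) * (1 / x.1)).sum = 0 := by
  simp only [coef, List.map_cons, List.map_nil, List.sum_cons, List.sum_nil]
  norm_num

theorem coef_sum_abs : (coef.map fun x => |(x.2 : ℝ)|).sum = 75 := by
  simp only [coef, List.map_cons, List.map_nil, List.sum_cons, List.sum_nil]
  norm_num

theorem log_smooth (a b c d : ℕ) : Real.log ((2 ^ a * 3 ^ b * 5 ^ c * 7 ^ d : ℕ) : ℝ) =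
    a * Real.log 2 + b * Real.log 3 + c * Real.log 5 + d * Real.log 7 := by
  push_cast
  rw [Real.log_mul (by positivity) (by positivity), Real.log_mul (by positivity) (by positivity),
    Real.log_mul (by positivity) (by positivity), Real.log_pow, Real.log_pow, Real.log_pow,
    Real.log_pow]

theorem coef_sum_log :
    0.00352 ≤ -(coef.map fun x => (x.2 : ℝ) * (Real.log x.1 / x.1)).sum := by
  have h8 := log_smooth 3 0 0 0
  have h9 := log_smooth 0 2 0 0
  have h16 := log_smooth 4 0 0 0
  have h18 := log_smooth 1 2 0 0
  have h24 := log_smooth 3 1 0 0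
  have h28 := log_smooth 2 0 0 1
  have h40 := log_smooth 3 0 1 0
  have h45 := log_smooth 0 2 1 0
  have h48 := log_smooth 4 1 0 0
  have h56 := log_smooth 3 0 0 1
  have h63 := log_smooth 0 2 0 1
  have h80 := log_smooth 4 0 1 0
  have h84 := log_smooth 2 1 0 1
  have h90 := log_smooth 1 2 1 0
  have h112 := log_smooth 4 0 0 1
  have h120 := log_smooth 3 1 1 0
  have h126 := log_smooth 1 2 0 1
  have h140 := log_smooth 2 0 1 1
  have h144 := log_smooth 4 2 0 0
  have h168 := log_smooth 3 1 0 1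
  have h240 := log_smooth 4 1 1 0
  have h280 := log_smooth 3 0 1 1
  have h336 := log_smooth 4 1 0 1
  have h420 := log_smooth 2 1 1 1
  have h504 := log_smooth 3 2 0 1
  have h560 := log_smooth 4 0 1 1
  have h630 := log_smooth 1 2 1 1
  have h840 := log_smooth 3 1 1 1
  have h1008 := log_smooth 4 2 0 1
  have h1680 := log_smooth 4 1 1 1
  have h2520 := log_smooth 3 2 1 1
  have h2 := Real.log_two_lt_d9
  have h3 := Real.log_three_gt_d9
  have h5 := log_five_lt
  have h7 := log_seven_lt
  simp only [coef, List.map_cons, List.map_nil, List.sum_cons, List.sum_nil]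
  norm_num at h8 h9 h16 h18 h24 h28 h40 h45 h48 h56 h63 h80 h84 h90 h112 h120 h126 h140 h144 h168 h240 h280 h336 h420 h504 h560 h630 h840 h1008 h1680 h2520 h2 h3 h5 h7 ⊢
  linarith

theorem final_ineq (M : ℝ) (hM : 270000000 ≤ M) :
    4 * √(M / 8) * Real.log M + 2 * (Real.log 4 * (M / 2216) + 2 * √(M / 2216) * Real.log M)
      < M * 0.00352 - 75 * (Real.log M + 1) := by
  have hM0 : 0 < M := by linarith
  set s := √M with hs
  have hs2 : s ^ 2 = M := Real.sq_sqrt hM0.le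
  have hs0 : 0 < s := Real.sqrt_pos.mpr hM0
  set u := √s with hu
  have hu2 : u ^ 2 = s := Real.sq_sqrt hs0.le
  have hu0 : 0 < u := Real.sqrt_pos.mpr hs0
  have hs1 : 16384 ≤ s := Real.le_sqrt_of_sq_le (by norm_num; linarith)
  have hu1 : 128 ≤ u := Real.le_sqrt_of_sq_le (by norm_num; linarith)
  have h8 : √(M / 8) ≤ 0.35356 * s := by
    rw [Real.sqrt_le_left (by positivity), mul_pow, hs2]
    norm_num; linarith
  have h2216 : √(M / 2216) ≤ 0.0213 * s := by
    rw [Real.sqrt_le_left (by positivity), mul_pow, hs2]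
    norm_num; linarith
  have hl2 := Real.log_two_lt_d9
  have hlog4 : Real.log 4 = 2 * Real.log 2 := by
    rw [show (4 : ℝ) = 2 ^ 2 by norm_num, Real.log_pow]; norm_num
  have hlogu : Real.log u ≤ u / 128 - 1 + 7 * Real.log 2 := by
    have h := Real.log_le_sub_one_of_pos (show 0 < u / 128 by positivity)
    rw [Real.log_div hu0.ne' (by norm_num), show (128 : ℝ) = 2 ^ 7 by norm_num,
      Real.log_pow] at h
    norm_num at h ⊢
    linarith
  have hlogM : Real.log M = 4 * Real.log u := by
    rw [← hs2, ← hu2, Real.log_pow, Real.log_pow]; norm_num; ring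
  have hL : Real.log M ≤ u / 32 + 15.4082 := by
    rw [hlogM]; norm_num at hl2 ⊢; linarith
  have hL0 : 0 ≤ Real.log M := Real.log_nonneg (by linarith)
  have e1 : √(M / 8) * Real.log M ≤ 0.35356 * s * (u / 32 + 15.4082) :=
    mul_le_mul h8 hL hL0 (by positivity)
  have e2 : √(M / 2216) * Real.log M ≤ 0.0213 * s * (u / 32 + 15.4082) :=
    mul_le_mul h2216 hL hL0 (by positivity)
  have e3 : Real.log 4 * (M / 2216) ≤ 1.3863 * (M / 2216) := by
    gcongr
    rw [hlog4]; norm_num at hl2 ⊢; linarith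
  have hMu : M = s * s := by rw [← hs2]; ring
  have k1 : s * 128 * u ≤ s * s := by
    rw [mul_assoc]
    refine mul_le_mul_of_nonneg_left ?_ hs0.le
    rw [← hu2, sq]
    exact mul_le_mul_of_nonneg_right hu1 hu0.le
  have k2 : 16384 * s ≤ s * s := mul_le_mul_of_nonneg_right hs1 hs0.le
  have k3 : 128 * u ≤ s := by rw [← hu2, sq]; exact mul_le_mul_of_nonneg_right hu1 hu0.le
  rw [hMu] at e1 e2 e3 hL ⊢
  norm_num at e1 e2 e3 hL ⊢
  nlinarith

theorem large_case (n : ℕ) (hn : 30000000 ≤ n) :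
    ∃ r : ℕ, r.Prime ∧ n ≤ r ∧ 8 * r ≤ 9 * (n + 3) := by
  by_contra hcon
  push Not at hcon
  set M := 9 * n with hMdef
  have hMn : 270000000 ≤ M := by omega
  have hM : ∀ p : ℕ, p.Prime → M / p ≠ 8 := by
    intro p hp h
    have hp0 := hp.pos
    have h1 : p * 8 ≤ M := by rw [← h]; exact Nat.mul_div_le M p
    have h2 : M < p * 9 := by
      have := Nat.lt_mul_div_succ M hp0
      rwa [h] at this
    have := hcon p hp (by omega)
    omega
  have hMr : (270000000 : ℝ) ≤ M := by exact_mod_cast hMn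
  have hup := wsum_le M hM
  have hlo := wsum_ge coef M (by
    have h : ∀ x ∈ coef, 1 ≤ x.1 ∧ x.1 ≤ 5040 := by decide +kernel
    intro x hx
    have := h x hx
    omega)
  rw [coef_sum_inv, coef_sum_abs] at hlo
  have hnum := coef_sum_log
  have hfin := final_ineq M hMr
  have c8 : ((M / 8 : ℕ) : ℝ) ≤ M / 8 := by exact_mod_cast Nat.cast_div_le (α := ℝ) (m := M) (n := 8)
  have c2216 : ((M / 2216 : ℕ) : ℝ) ≤ M / 2216 := by
    exact_mod_cast Nat.cast_div_le (α := ℝ) (m := M) (n := 2216)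
  have d8 : (1 : ℝ) ≤ ((M / 8 : ℕ) : ℝ) := by
    exact_mod_cast (show 1 ≤ M / 8 by omega)
  have d2216 : (1 : ℝ) ≤ (M : ℝ) / 2216 := by linarith
  have b1 : psi ((M / 8 : ℕ) : ℝ) - theta ((M / 8 : ℕ) : ℝ) ≤ 2 * √((M : ℝ) / 8) * Real.log M := by
    refine (psi_sub_theta_le d8).trans ?_
    refine mul_le_mul ?_ ?_ (Real.log_nonneg d8) (by positivity)
    · exact mul_le_mul_of_nonneg_left (Real.sqrt_le_sqrt c8) zero_le_two
    · exact Real.log_le_log (by linarith) (by linarith)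
  have b2 : psi ((M / 2216 : ℕ) : ℝ) ≤
      Real.log 4 * ((M : ℝ) / 2216) + 2 * √((M : ℝ) / 2216) * Real.log M := by
    refine (psi_mono c2216).trans ((psi_le d2216).trans ?_)
    refine add_le_add le_rfl (mul_le_mul_of_nonneg_left ?_ (by positivity))
    exact Real.log_le_log (by linarith) (by linarith)
  have hk := mul_le_mul_of_nonneg_left hnum (show (0 : ℝ) ≤ M by positivity)
  linarith

end Breusch

theorem breusch_interval_contains_prime (n : ℕ) (hn : 0 < n) :
    ∃ p : ℕ, p.Prime ∧ n ≤ p ∧ 8 * p ≤ 9 * (n + 3) := by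
  rcases le_total n 30000000 with h | h
  · exact Breusch.small_case n h
  · exact Breusch.large_case n h
end

section
/- If a is a positive integer, then for every integer n > 12a there exists at least one prime number p such that n < a·p < 3n/2 (equivalently, 2n < 2ap < 3n). -/
open Finset in
theorem aux_log_fact (N : ℕ) :
    Real.log (N.factorial) =
      ∑ d ∈ Ioc 0 N, ArithmeticFunction.vonMangoldt d * ((N / d : ℕ) : ℝ) := by
  rw [← ArithmeticFunction.sum_Ioc_mul_zeta_eq_sum]
  rw [ArithmeticFunction.vonMangoldt_mul_zeta]
  induction N with
  | zero => simp
  | succ k ih =>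
    rw [Nat.factorial_succ, ← Finset.insert_Ioc_right_eq_Ioc_add_one (Nat.zero_le k),
      Finset.sum_insert (by simp), ← ih]
    push_cast
    rw [Real.log_mul (by positivity) (by positivity)]
    simp [ArithmeticFunction.log_apply]

open Finset in
theorem aux_log_fact' (N M : ℕ) (h : N ≤ M) :
    Real.log (N.factorial) =
      ∑ d ∈ Ioc 0 M, ArithmeticFunction.vonMangoldt d * ((N / d : ℕ) : ℝ) := by
  rw [aux_log_fact]
  apply Finset.sum_subset (Finset.Ioc_subset_Ioc_right h)
  intro d hd hd'
  simp only [Finset.mem_Ioc, not_and, not_le] at hd hd'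
  rw [Nat.div_eq_of_lt (hd' hd.1)]
  simp

noncomputable def auxE (n : ℕ) : ℝ :=
  Real.log ((30 * n).factorial) + Real.log (n.factorial) - Real.log ((15 * n).factorial)
    - Real.log ((10 * n).factorial) - Real.log ((6 * n).factorial)

theorem aux_floor (n d : ℕ) (hd : 0 < d) :
    15 * n / d + 10 * n / d + 6 * n / d ≤ 30 * n / d + n / d ∧
    30 * n / d + n / d ≤ 15 * n / d + 10 * n / d + 6 * n / d + 1 := by
  have key : ∀ x : ℕ, d * (x / d) ≤ x ∧ x < d * (x / d) + d := fun x =>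
    ⟨Nat.mul_div_le x d, by have := Nat.lt_mul_div_succ x hd; rw [mul_add, mul_one] at this; exact this⟩
  have e15 : 15 * n / d = (30 * n / d) / 2 := by
    rw [Nat.div_div_eq_div_mul, mul_comm d, ← Nat.div_div_eq_div_mul]; congr 1; omega
  have e10 : 10 * n / d = (30 * n / d) / 3 := by
    rw [Nat.div_div_eq_div_mul, mul_comm d, ← Nat.div_div_eq_div_mul]; congr 1; omega
  have e6 : 6 * n / d = (30 * n / d) / 5 := by
    rw [Nat.div_div_eq_div_mul, mul_comm d, ← Nat.div_div_eq_div_mul]; congr 1; omega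
  have e1 : n / d = (30 * n / d) / 30 := by
    rw [Nat.div_div_eq_div_mul, mul_comm d, ← Nat.div_div_eq_div_mul]; congr 1; omega
  rw [e15, e10, e6, e1]
  omega

theorem aux_floor' (n d : ℕ) (h1 : 5 * n < d) (h2 : d ≤ 30 * n) :
    30 * n / d + n / d = 15 * n / d + 10 * n / d + 6 * n / d + 1 := by
  have hd : 0 < d := by omega
  have e15 : 15 * n / d = (30 * n / d) / 2 := by
    rw [Nat.div_div_eq_div_mul, mul_comm d, ← Nat.div_div_eq_div_mul]; congr 1; omega
  have e10 : 10 * n / d = (30 * n / d) / 3 := by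
    rw [Nat.div_div_eq_div_mul, mul_comm d, ← Nat.div_div_eq_div_mul]; congr 1; omega
  have e6 : 6 * n / d = (30 * n / d) / 5 := by
    rw [Nat.div_div_eq_div_mul, mul_comm d, ← Nat.div_div_eq_div_mul]; congr 1; omega
  have e1 : n / d = (30 * n / d) / 30 := by
    rw [Nat.div_div_eq_div_mul, mul_comm d, ← Nat.div_div_eq_div_mul]; congr 1; omega
  have l1 : 1 ≤ 30 * n / d := (Nat.le_div_iff_mul_le hd).2 (by omega)
  have l2 : 30 * n / d < 6 := (Nat.div_lt_iff_lt_mul hd).2 (by omega)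
  rw [e15, e10, e6, e1]
  omega

open Finset in
theorem auxE_eq (n : ℕ) :
    auxE n = ∑ d ∈ Ioc 0 (30 * n), ArithmeticFunction.vonMangoldt d *
      (((30 * n / d : ℕ) : ℝ) + ((n / d : ℕ) : ℝ) - ((15 * n / d : ℕ) : ℝ)
        - ((10 * n / d : ℕ) : ℝ) - ((6 * n / d : ℕ) : ℝ)) := by
  unfold auxE
  rw [aux_log_fact' (30 * n) (30 * n) le_rfl, aux_log_fact' n (30 * n) (by omega),
    aux_log_fact' (15 * n) (30 * n) (by omega), aux_log_fact' (10 * n) (30 * n) (by omega),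
    aux_log_fact' (6 * n) (30 * n) (by omega)]
  simp only [mul_sub, mul_add, Finset.sum_sub_distrib, Finset.sum_add_distrib]

theorem aux_psi (N : ℕ) :
    Chebyshev.psi (N : ℝ) = ∑ d ∈ Finset.Ioc 0 N, ArithmeticFunction.vonMangoldt d := by
  rw [Chebyshev.psi, Nat.floor_natCast]

theorem auxE_le (n : ℕ) : auxE n ≤ Chebyshev.psi ((30 * n : ℕ) : ℝ) := by
  rw [auxE_eq, aux_psi]
  apply Finset.sum_le_sum
  intro d hd
  rw [Finset.mem_Ioc] at hd
  have h := (aux_floor n d hd.1).2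
  have h' : ((30 * n / d : ℕ) : ℝ) + ((n / d : ℕ) : ℝ) ≤ ((15 * n / d : ℕ) : ℝ)
        + ((10 * n / d : ℕ) : ℝ) + ((6 * n / d : ℕ) : ℝ) + 1 := by exact_mod_cast h
  exact mul_le_of_le_one_right ArithmeticFunction.vonMangoldt_nonneg (by linarith)

theorem le_auxE (n : ℕ) :
    Chebyshev.psi ((30 * n : ℕ) : ℝ) ≤ Chebyshev.psi ((5 * n : ℕ) : ℝ) + auxE n := by
  rw [auxE_eq, aux_psi, aux_psi]
  have : ∑ d ∈ Finset.Ioc 0 (5 * n), ArithmeticFunction.vonMangoldt d =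
      ∑ d ∈ Finset.Ioc 0 (30 * n), if d ≤ 5 * n then ArithmeticFunction.vonMangoldt d else 0 := by
    rw [← Finset.sum_filter]
    congr 1
    ext d
    simp only [Finset.mem_Ioc, Finset.mem_filter]
    omega
  rw [this, ← Finset.sum_add_distrib]
  apply Finset.sum_le_sum
  intro d hd
  rw [Finset.mem_Ioc] at hd
  have hL : 0 ≤ ArithmeticFunction.vonMangoldt d := ArithmeticFunction.vonMangoldt_nonneg
  split_ifs with hc
  · have h := (aux_floor n d hd.1).1
    have h' : ((15 * n / d : ℕ) : ℝ) + ((10 * n / d : ℕ) : ℝ) + ((6 * n / d : ℕ) : ℝ) ≤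
      ((30 * n / d : ℕ) : ℝ) + ((n / d : ℕ) : ℝ) := by exact_mod_cast h
    have := mul_nonneg hL (show (0 : ℝ) ≤ ((30 * n / d : ℕ) : ℝ) + ((n / d : ℕ) : ℝ)
      - ((15 * n / d : ℕ) : ℝ) - ((10 * n / d : ℕ) : ℝ) - ((6 * n / d : ℕ) : ℝ) by linarith)
    linarith
  · have h := aux_floor' n d (by omega) hd.2
    have h' : ((30 * n / d : ℕ) : ℝ) + ((n / d : ℕ) : ℝ) = ((15 * n / d : ℕ) : ℝ)
        + ((10 * n / d : ℕ) : ℝ) + ((6 * n / d : ℕ) : ℝ) + 1 := by exact_mod_cast h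
    rw [h']
    ring_nf
    rfl

theorem fact_lower (N : ℕ) (hN : 0 < N) :
    (N : ℝ) * Real.log N - N ≤ Real.log (N.factorial) := by
  have h := Stirling.le_log_factorial_stirling hN.ne'
  have h1 : (0 : ℝ) ≤ Real.log N := Real.log_natCast_nonneg N
  have h2 : 0 ≤ Real.log (2 * Real.pi) := Real.log_nonneg (by linarith [Real.pi_gt_three])
  linarith

theorem fact_upper (N : ℕ) (hN : 0 < N) :
    Real.log (N.factorial) ≤ (N : ℝ) * Real.log N - N + Real.log N + 1 := by
  induction N, hN using Nat.le_induction with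
  | base => simp
  | succ k hk ih =>
    have hk' : (0 : ℝ) < k := by exact_mod_cast hk
    rw [Nat.factorial_succ]
    push_cast
    rw [Real.log_mul (by positivity) (by positivity)]
    have h := Real.log_le_sub_one_of_pos (show (0 : ℝ) < k / (k + 1) by positivity)
    rw [Real.log_div (by positivity) (by positivity)] at h
    have h3 : (k + 1 : ℝ) * (k / (k + 1) - 1) = -1 := by field_simp; ring
    have h4 := mul_le_mul_of_nonneg_left h (show (0 : ℝ) ≤ k + 1 by positivity)
    rw [h3] at h4
    nlinarith

theorem log_bd (n : ℕ) (hn : 0 < n) : Real.log n ≤ n / 64 + 16 / 5 := by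
  have hn' : (0 : ℝ) < n := by exact_mod_cast hn
  have h := Real.log_le_sub_one_of_pos (show (0 : ℝ) < n / 64 by positivity)
  rw [Real.log_div (by positivity) (by positivity),
    show (64 : ℝ) = 2 ^ 6 by norm_num, Real.log_pow] at h
  have := Real.log_two_lt_d9
  norm_num at h this ⊢
  linarith

theorem logs (n : ℕ) (hn : 0 < n) :
    Real.log ((30 * n : ℕ) : ℝ) = Real.log 2 + Real.log 3 + Real.log 5 + Real.log n ∧
    Real.log ((15 * n : ℕ) : ℝ) = Real.log 3 + Real.log 5 + Real.log n ∧
    Real.log ((10 * n : ℕ) : ℝ) = Real.log 2 + Real.log 5 + Real.log n ∧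
    Real.log ((6 * n : ℕ) : ℝ) = Real.log 2 + Real.log 3 + Real.log n := by
  have hn' : (n : ℝ) ≠ 0 := by positivity
  push_cast
  refine ⟨?_, ?_, ?_, ?_⟩
  · rw [show (30 : ℝ) = 2 * 3 * 5 by norm_num, Real.log_mul (by norm_num) hn',
      Real.log_mul (by norm_num) (by norm_num), Real.log_mul (by norm_num) (by norm_num)]
  · rw [show (15 : ℝ) = 3 * 5 by norm_num, Real.log_mul (by norm_num) hn',
      Real.log_mul (by norm_num) (by norm_num)]
  · rw [show (10 : ℝ) = 2 * 5 by norm_num, Real.log_mul (by norm_num) hn',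
      Real.log_mul (by norm_num) (by norm_num)]
  · rw [show (6 : ℝ) = 2 * 3 by norm_num, Real.log_mul (by norm_num) hn',
      Real.log_mul (by norm_num) (by norm_num)]

theorem auxE_bounds (n : ℕ) (hn : 0 < n) :
    auxE n ≤ 27.69 * n + 12 ∧ 27.55 * n - 23 ≤ auxE n := by
  obtain ⟨l30, l15, l10, l6⟩ := logs n hn
  have hn' : (0 : ℝ) < n := by exact_mod_cast hn
  have u30 := fact_upper (30 * n) (by omega)
  have u15 := fact_upper (15 * n) (by omega)
  have u10 := fact_upper (10 * n) (by omega)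
  have u6 := fact_upper (6 * n) (by omega)
  have u1 := fact_upper n hn
  have v30 := fact_lower (30 * n) (by omega)
  have v15 := fact_lower (15 * n) (by omega)
  have v10 := fact_lower (10 * n) (by omega)
  have v6 := fact_lower (6 * n) (by omega)
  have v1 := fact_lower n hn
  rw [l30] at u30 v30
  rw [l15] at u15 v15
  rw [l10] at u10 v10
  rw [l6] at u6 v6
  push_cast at u30 v30 u15 v15 u10 v10 u6 v6
  have a2 := Real.log_two_lt_d9
  have b2 := Real.log_two_gt_d9
  have a3 := Real.log_three_lt_d9
  have b3 := Real.log_three_gt_d9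
  have a5 := Real.log_five_lt_d9
  have b5 := Real.log_five_gt_d9
  have L := log_bd n hn
  have c2 := mul_lt_mul_of_pos_left a2 hn'
  have d2 := mul_lt_mul_of_pos_left b2 hn'
  have c3 := mul_lt_mul_of_pos_left a3 hn'
  have d3 := mul_lt_mul_of_pos_left b3 hn'
  have c5 := mul_lt_mul_of_pos_left a5 hn'
  have d5 := mul_lt_mul_of_pos_left b5 hn'
  unfold auxE
  norm_num at a2 b2 a3 b3 a5 b5 c2 d2 c3 d3 c5 d5 ⊢
  constructor <;> linarith

theorem psi_bd (N : ℕ) : Chebyshev.psi (N : ℝ) ≤ 1.2 * N + 4000 := by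
  induction N using Nat.strong_induction_on with
  | _ N ih =>
    have hN0 : (0 : ℝ) ≤ N := by positivity
    by_cases h : N < 660
    · have h1 := Chebyshev.psi_le_const_mul_self hN0
      have h2 : Real.log 4 = 2 * Real.log 2 := by
        rw [show (4 : ℝ) = 2 ^ 2 by norm_num, Real.log_pow]; norm_num
      have := Real.log_two_lt_d9
      have hN : (N : ℝ) < 660 := by exact_mod_cast h
      rw [h2] at h1
      norm_num at this ⊢
      nlinarith
    · obtain ⟨n, hn1, hn2⟩ : ∃ n, N ≤ 30 * n ∧ 30 * n < N + 30 := ⟨(N + 29) / 30, by omega, by omega⟩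
      have h1 : Chebyshev.psi (N : ℝ) ≤ Chebyshev.psi ((30 * n : ℕ) : ℝ) :=
        Chebyshev.psi_mono (by exact_mod_cast hn1)
      have h2 := le_auxE n
      have h3 := (auxE_bounds n (by omega)).1
      have h4 := ih (5 * n) (by omega)
      have h5 : (30 * n : ℝ) < N + 30 := by exact_mod_cast hn2
      have h6 : (22 : ℝ) ≤ n := by exact_mod_cast (show 22 ≤ n by omega)
      push_cast at h1 h2 h3 h4
      norm_num at h3 h4 ⊢
      linarith

theorem large (m : ℕ) (hm : 1000000 ≤ m) : ∃ p : ℕ, p.Prime ∧ m < p ∧ 2 * p < 3 * m := by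
  by_contra! hcon
  obtain ⟨n, hn1, hn2⟩ : ∃ n, 60 * n < 3 * m ∧ 3 * m ≤ 60 * n + 60 :=
    ⟨(3 * m - 1) / 60, by omega, by omega⟩
  have hn : 49000 ≤ n := by omega
  have hnr : (49000 : ℝ) ≤ n := by exact_mod_cast hn
  have hθ : Chebyshev.theta ((30 * n : ℕ) : ℝ) ≤ Chebyshev.theta (m : ℝ) := by
    rw [Chebyshev.theta, Chebyshev.theta, Nat.floor_natCast, Nat.floor_natCast]
    apply Finset.sum_le_sum_of_subset_of_nonneg
    · intro p hp
      simp only [Finset.mem_filter, Finset.mem_Ioc] at hp ⊢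
      refine ⟨⟨hp.1.1, ?_⟩, hp.2⟩
      by_contra hlt
      have := hcon p hp.2 (by omega)
      omega
    · intro p _ _
      exact Real.log_natCast_nonneg p
  have h1 := Chebyshev.theta_le_psi (m : ℝ)
  have h2 := psi_bd m
  have h3 := auxE_le n
  have h4 := (auxE_bounds n (by omega)).2
  have h5 := Chebyshev.psi_sub_theta_le (x := ((30 * n : ℕ) : ℝ))
    (by exact_mod_cast (show 1 ≤ 30 * n by omega))
  have hmr : (3 * m : ℝ) ≤ 60 * n + 60 := by exact_mod_cast hn2
  set x : ℝ := ((30 * n : ℕ) : ℝ) with hx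
  have hxn : x = 30 * n := by rw [hx]; push_cast; ring
  set s := √x with hs
  have hx0 : 0 ≤ x := by rw [hxn]; positivity
  have hss : s * s = x := Real.mul_self_sqrt hx0
  have hs1 : 1000 ≤ s := Real.le_sqrt_of_sq_le (by rw [hxn]; norm_num; linarith)
  have hlx : Real.log x ≤ 2 * (s / 128 + 3.86) := by
    rw [← hss, Real.log_mul (by positivity) (by positivity)]
    have h := Real.log_le_sub_one_of_pos (show (0 : ℝ) < s / 128 by positivity)
    rw [Real.log_div (by positivity) (by positivity),
      show (128 : ℝ) = 2 ^ 7 by norm_num, Real.log_pow] at h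
    have := Real.log_two_lt_d9
    norm_num at h this ⊢
    linarith
  have h6 : 2 * s * Real.log x ≤ 2 * s * (2 * (s / 128 + 3.86)) :=
    mul_le_mul_of_nonneg_left hlx (by positivity)
  have h7 : 1000 * s ≤ x := by nlinarith
  have h8 : 2 * s * (2 * (s / 128 + 3.86)) = x / 32 + 15.44 * s := by
    rw [← hss]; ring
  norm_num at h2 h4 h6 h8
  linarith

theorem step {m : ℕ} (q : ℕ) {p : ℕ} (hp : p.Prime) (hc : 2 * p < 3 * q)
    (H : m < q → ∃ p : ℕ, p.Prime ∧ m < p ∧ 2 * p < 3 * m) (hm : m < p) :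
    ∃ p : ℕ, p.Prime ∧ m < p ∧ 2 * p < 3 * m := by
  by_cases h : m < q
  · exact H h
  · exact ⟨p, hp, hm, by omega⟩

theorem all_m (m : ℕ) (hm : 12 ≤ m) : ∃ p : ℕ, p.Prime ∧ m < p ∧ 2 * p < 3 * m := by
  by_cases h : 1000000 ≤ m
  · exact large m h
  have h : m < 1382393 := by omega
  revert h
  refine step 921611 (by norm_num1) (by norm_num1) ?_
  refine step 614413 (by norm_num1) (by norm_num1) ?_
  refine step 409609 (by norm_num1) (by norm_num1) ?_
  refine step 273083 (by norm_num1) (by norm_num1) ?_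
  refine step 182059 (by norm_num1) (by norm_num1) ?_
  refine step 121379 (by norm_num1) (by norm_num1) ?_
  refine step 80923 (by norm_num1) (by norm_num1) ?_
  refine step 53951 (by norm_num1) (by norm_num1) ?_
  refine step 35969 (by norm_num1) (by norm_num1) ?_
  refine step 23981 (by norm_num1) (by norm_num1) ?_
  refine step 15991 (by norm_num1) (by norm_num1) ?_
  refine step 10667 (by norm_num1) (by norm_num1) ?_
  refine step 7121 (by norm_num1) (by norm_num1) ?_
  refine step 4751 (by norm_num1) (by norm_num1) ?_
  refine step 3169 (by norm_num1) (by norm_num1) ?_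
  refine step 2113 (by norm_num1) (by norm_num1) ?_
  refine step 1409 (by norm_num1) (by norm_num1) ?_
  refine step 941 (by norm_num1) (by norm_num1) ?_
  refine step 631 (by norm_num1) (by norm_num1) ?_
  refine step 421 (by norm_num1) (by norm_num1) ?_
  refine step 283 (by norm_num1) (by norm_num1) ?_
  refine step 193 (by norm_num1) (by norm_num1) ?_
  refine step 131 (by norm_num1) (by norm_num1) ?_
  refine step 89 (by norm_num1) (by norm_num1) ?_
  refine step 61 (by norm_num1) (by norm_num1) ?_
  refine step 43 (by norm_num1) (by norm_num1) ?_
  refine step 31 (by norm_num1) (by norm_num1) ?_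
  refine step 23 (by norm_num1) (by norm_num1) ?_
  refine step 19 (by norm_num1) (by norm_num1) ?_
  refine step 13 (by norm_num1) (by norm_num1) ?_
  exact fun h => ⟨13, by norm_num, h, by omega⟩

theorem exists_prime_mul_between (a : ℕ) (ha : 0 < a) (n : ℕ) (hn : n > 12 * a) :
    ∃ p : ℕ, p.Prime ∧ 2 * n < 2 * (a * p) ∧ 2 * (a * p) < 3 * n := by
  obtain ⟨p, hp, h1, h2⟩ := all_m (n / a) ((Nat.le_div_iff_mul_le ha).2 (by omega))
  refine ⟨p, hp, ?_, ?_⟩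
  · have := (Nat.div_lt_iff_lt_mul ha).1 h1
    rw [mul_comm p a] at this
    omega
  · have h3 := Nat.mul_div_le n a
    have h4 := Nat.mul_lt_mul_of_pos_left h2 ha
    nlinarith
end

section
/- For every integer n > 14.4 (equivalently, every integer n ≥ 15) there exist prime numbers r and s such that n < r < 3n/2 < s < 2n (equivalently, 2n < 2r < 3n < 2s < 4n). -/
namespace PrimePair
open Real Finset
open ArithmeticFunction (vonMangoldt)

lemma log_fact_le (n : ℕ) (hn : 1 ≤ n) :
    log (n.factorial : ℝ) ≤ n * log n - n + log n + 1 := by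
  induction n, hn using Nat.le_induction with
  | base => simp
  | succ n hn ih =>
    have h0 : (0:ℝ) < n := by exact_mod_cast hn
    rw [Nat.factorial_succ, Nat.cast_mul, log_mul (by positivity) (by positivity)]
    have h1 := one_sub_inv_le_log_of_pos (x := ((n:ℝ) + 1) / n) (by positivity)
    rw [log_div (by positivity) (by positivity), inv_div] at h1
    have h2 : 1 - (n:ℝ) / (n + 1) = 1 / (n + 1) := by field_simp; ring
    rw [h2, div_le_iff₀ (by positivity)] at h1
    push_cast
    nlinarith

lemma le_log_fact (n : ℕ) (hn : 1 ≤ n) :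
    n * log n - n ≤ log (n.factorial : ℝ) := by
  have h := Stirling.le_log_factorial_stirling (n := n) (by omega)
  have h1 : 0 ≤ log (n:ℝ) := log_natCast_nonneg n
  have h2 : 0 ≤ log (2 * π) := log_nonneg (by nlinarith [pi_gt_three])
  linarith

lemma log_fact_eq (N M : ℕ) (h : N ≤ M) :
    log (N.factorial : ℝ) = ∑ m ∈ Ioc 0 M, vonMangoldt m * ((N / m : ℕ) : ℝ) := by
  have h1 : log (N.factorial : ℝ) = ∑ m ∈ Ioc 0 N, log (m : ℝ) := by
    clear h
    induction N with
    | zero => simp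
    | succ n ih =>
      rw [Nat.factorial_succ, Nat.cast_mul, log_mul (by positivity) (by positivity), ih,
        ← Finset.insert_Ioc_right_eq_Ioc_add_one (by omega), Finset.sum_insert (by simp)]
  have h2 := ArithmeticFunction.sum_Ioc_mul_zeta_eq_sum vonMangoldt N
  rw [ArithmeticFunction.vonMangoldt_mul_zeta] at h2
  rw [h1]
  simp only [ArithmeticFunction.log_apply] at h2
  rw [h2]
  apply Finset.sum_subset (Finset.Ioc_subset_Ioc_right h)
  intro x hx hx'
  simp only [Finset.mem_Ioc] at hx hx'
  rw [Nat.div_eq_of_lt (by omega)]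
  simp

noncomputable def S (j : ℕ) : ℝ :=
  log ((30 * j).factorial : ℝ) - log ((15 * j).factorial : ℝ) - log ((10 * j).factorial : ℝ)
    - log ((6 * j).factorial : ℝ) + log (j.factorial : ℝ)

lemma S_eq (j : ℕ) : S j = ∑ m ∈ Ioc 0 (30 * j), vonMangoldt m *
    (((30 * j / m : ℕ) : ℝ) - ((30 * j / m / 2 : ℕ) : ℝ) - ((30 * j / m / 3 : ℕ) : ℝ)
      - ((30 * j / m / 5 : ℕ) : ℝ) + ((30 * j / m / 30 : ℕ) : ℝ)) := by
  unfold S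
  rw [log_fact_eq (30 * j) (30 * j) le_rfl, log_fact_eq (15 * j) (30 * j) (by omega),
    log_fact_eq (10 * j) (30 * j) (by omega), log_fact_eq (6 * j) (30 * j) (by omega),
    log_fact_eq j (30 * j) (by omega), ← sum_sub_distrib, ← sum_sub_distrib,
    ← sum_sub_distrib, ← sum_add_distrib]
  apply sum_congr rfl
  intro m _
  have e (a b : ℕ) (h : 30 * j / a = b) : 30 * j / m / a = b / m := by
    rw [Nat.div_div_eq_div_mul, mul_comm m a, ← Nat.div_div_eq_div_mul, h]
  rw [e 2 (15 * j) (by omega), e 3 (10 * j) (by omega), e 5 (6 * j) (by omega),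
    e 30 j (by omega)]
  ring

lemma S_le_psi (j : ℕ) : S j ≤ Chebyshev.psi ((30 * j : ℕ) : ℝ) := by
  rw [S_eq, Chebyshev.psi, Nat.floor_natCast]
  apply sum_le_sum
  intro m _
  apply mul_le_of_le_one_right ArithmeticFunction.vonMangoldt_nonneg
  generalize 30 * j / m = u
  have : u + u / 30 ≤ 1 + u / 2 + u / 3 + u / 5 := by omega
  have : ((u + u / 30 : ℕ) : ℝ) ≤ ((1 + u / 2 + u / 3 + u / 5 : ℕ) : ℝ) := by exact_mod_cast this
  push_cast at this
  linarith

lemma psi_le_S (j : ℕ) :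
    Chebyshev.psi ((30 * j : ℕ) : ℝ) ≤ S j + Chebyshev.psi ((5 * j : ℕ) : ℝ) := by
  rw [S_eq, Chebyshev.psi, Chebyshev.psi, Nat.floor_natCast, Nat.floor_natCast]
  have h : ∑ m ∈ Ioc 0 (5 * j), vonMangoldt m
      = ∑ m ∈ Ioc 0 (30 * j), if m ≤ 5 * j then vonMangoldt m else 0 := by
    rw [← sum_filter]
    congr 1
    ext m
    simp only [mem_Ioc, mem_filter]
    omega
  rw [h, ← sum_add_distrib]
  apply sum_le_sum
  intro m hm
  rw [mem_Ioc] at hm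
  have h0 : 0 ≤ vonMangoldt m := ArithmeticFunction.vonMangoldt_nonneg
  have key (u c : ℕ) (hu : 1 ≤ u + c) (hc : u < 6 ∨ c = 1) : (1 : ℝ) ≤
      ((u : ℝ) - ((u / 2 : ℕ) : ℝ) - ((u / 3 : ℕ) : ℝ)
      - ((u / 5 : ℕ) : ℝ) + ((u / 30 : ℕ) : ℝ)) + c := by
    have : 1 + u / 2 + u / 3 + u / 5 ≤ u + u / 30 + c := by omega
    have : ((1 + u / 2 + u / 3 + u / 5 : ℕ) : ℝ) ≤ ((u + u / 30 + c : ℕ) : ℝ) := by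
      exact_mod_cast this
    push_cast at this
    linarith
  split_ifs with hmj
  · have := key (30 * j / m) 1 (Nat.le_add_left _ _) (Or.inr rfl)
    push_cast at this
    nlinarith
  · have h1 : 1 ≤ 30 * j / m := (Nat.one_le_div_iff hm.1).2 hm.2
    have h2 : 30 * j / m < 6 := (Nat.div_lt_iff_lt_mul hm.1).2 (by omega)
    have := key (30 * j / m) 0 (by omega) (by omega)
    push_cast at this
    nlinarith

noncomputable def B : ℝ := 14 * log 2 + 9 * log 3 + 5 * log 5

lemma B_bounds : 39 * log 2 ≤ B ∧ B ≤ 40 * log 2 := by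
  have h : 9 * log 3 + 5 * log 5 = log (3 ^ 9 * 5 ^ 5 : ℝ) := by
    rw [log_mul (by norm_num) (by norm_num), log_pow, log_pow]; norm_num
  have h1 : 25 * log 2 ≤ log (3 ^ 9 * 5 ^ 5 : ℝ) := by
    have : 25 * log 2 = log (2 ^ 25 : ℝ) := by rw [log_pow]; norm_num
    rw [this]; exact log_le_log (by norm_num) (by norm_num)
  have h2 : log (3 ^ 9 * 5 ^ 5 : ℝ) ≤ 26 * log 2 := by
    have : 26 * log 2 = log (2 ^ 26 : ℝ) := by rw [log_pow]; norm_num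
    rw [this]; exact log_le_log (by norm_num) (by norm_num)
  unfold B
  constructor <;> linarith

lemma S_bounds (j : ℕ) (hj : 1 ≤ j) :
    B * j - 3 * (log ((30 * j : ℕ) : ℝ) + 1) ≤ S j ∧
    S j ≤ B * j + 2 * (log ((30 * j : ℕ) : ℝ) + 1) := by
  have a1 := log_fact_le (30 * j) (by omega)
  have a2 := log_fact_le (15 * j) (by omega)
  have a3 := log_fact_le (10 * j) (by omega)
  have a4 := log_fact_le (6 * j) (by omega)
  have a5 := log_fact_le j (by omega)
  have b1 := le_log_fact (30 * j) (by omega)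
  have b2 := le_log_fact (15 * j) (by omega)
  have b3 := le_log_fact (10 * j) (by omega)
  have b4 := le_log_fact (6 * j) (by omega)
  have b5 := le_log_fact j (by omega)
  have j0 : (j : ℝ) ≠ 0 := by positivity
  have l30 : log (((30 * j : ℕ)) : ℝ) = log 2 + log 3 + log 5 + log j := by
    push_cast
    rw [log_mul (by norm_num) j0, show (30:ℝ) = 2 * 3 * 5 by norm_num,
      log_mul (by norm_num) (by norm_num), log_mul (by norm_num) (by norm_num)]
  have l15 : log (((15 * j : ℕ)) : ℝ) = log 3 + log 5 + log j := by
    push_cast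
    rw [log_mul (by norm_num) j0, show (15:ℝ) = 3 * 5 by norm_num,
      log_mul (by norm_num) (by norm_num)]
  have l10 : log (((10 * j : ℕ)) : ℝ) = log 2 + log 5 + log j := by
    push_cast
    rw [log_mul (by norm_num) j0, show (10:ℝ) = 2 * 5 by norm_num,
      log_mul (by norm_num) (by norm_num)]
  have l6 : log (((6 * j : ℕ)) : ℝ) = log 2 + log 3 + log j := by
    push_cast
    rw [log_mul (by norm_num) j0, show (6:ℝ) = 2 * 3 by norm_num,
      log_mul (by norm_num) (by norm_num)]
  have p2 : 0 ≤ log (2:ℝ) := log_nonneg (by norm_num)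
  have p3 : 0 ≤ log (3:ℝ) := log_nonneg (by norm_num)
  have p5 : 0 ≤ log (5:ℝ) := log_nonneg (by norm_num)
  have pj : 0 ≤ log (j:ℝ) := log_natCast_nonneg j
  rw [l30] at a1 b1 ⊢
  rw [l15] at a2 b2
  rw [l10] at a3 b3
  rw [l6] at a4 b4
  push_cast at a1 a2 a3 a4 b1 b2 b3 b4
  unfold S B
  constructor <;> linarith

lemma large (k : ℕ) (hk : 2 ^ 24 ≤ k) : ∃ p : ℕ, p.Prime ∧ k < 2 * p ∧ 6 * p < 4 * k := by
  by_contra! hcon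
  obtain ⟨j₁, hj₁⟩ : ∃ j, j = k / 60 + 1 := ⟨_, rfl⟩
  obtain ⟨j₂, hj₂⟩ : ∃ j, j = (k - 1) / 45 := ⟨_, rfl⟩
  have hθ : Chebyshev.theta ((30 * j₂ : ℕ) : ℝ) ≤ Chebyshev.theta ((30 * j₁ : ℕ) : ℝ) := by
    rw [Chebyshev.theta, Chebyshev.theta, Nat.floor_natCast, Nat.floor_natCast]
    apply sum_le_sum_of_subset_of_nonneg
    · intro p hp
      simp only [mem_filter, mem_Ioc] at hp ⊢
      refine ⟨⟨hp.1.1, ?_⟩, hp.2⟩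
      by_contra hlt
      have := hcon p hp.2 (by omega)
      omega
    · intro p _ _
      exact log_natCast_nonneg p
  have u1 := (S_bounds j₁ (by omega)).2
  have u2 := (S_bounds j₂ (by omega)).1
  have u3 := psi_le_S j₁
  have u4 := S_le_psi j₂
  have u5 := Chebyshev.theta_le_psi ((30 * j₁ : ℕ) : ℝ)
  have u6 := Chebyshev.psi_sub_theta_le (x := ((30 * j₂ : ℕ) : ℝ)) (by
    exact_mod_cast (by omega : 1 ≤ 30 * j₂))
  have u7 := Chebyshev.psi_le (x := ((5 * j₁ : ℕ) : ℝ)) (by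
    exact_mod_cast (by omega : 1 ≤ 5 * j₁))
  have hk0 : (0:ℝ) < k := by exact_mod_cast (by omega : 0 < k)
  have lk (m : ℕ) (h0 : 0 < m) (h : m ≤ k) : log (m : ℝ) ≤ log k :=
    log_le_log (by exact_mod_cast h0) (by exact_mod_cast h)
  have sk (m : ℕ) (h : m ≤ k) : √(m : ℝ) ≤ √k := sqrt_le_sqrt (by exact_mod_cast h)
  have q1 := lk (30 * j₁) (by omega) (by omega)
  have q2 := lk (30 * j₂) (by omega) (by omega)
  have q3 := lk (5 * j₁) (by omega) (by omega)
  have s2 := sk (30 * j₂) (by omega)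
  have s3 := sk (5 * j₁) (by omega)
  have lk0 : 0 ≤ log (k : ℝ) := log_natCast_nonneg k
  have r2 : 2 * √((30 * j₂ : ℕ) : ℝ) * log ((30 * j₂ : ℕ) : ℝ) ≤ 2 * √k * log k := by gcongr
  have r3 : 2 * √((5 * j₁ : ℕ) : ℝ) * log ((5 * j₁ : ℕ) : ℝ) ≤ 2 * √k * log k := by gcongr
  have l4 : log (4:ℝ) = 2 * log 2 := by
    rw [show (4:ℝ) = 2 ^ 2 by norm_num, log_pow]; norm_num
  have c1 : (j₁ : ℝ) ≤ k / 60 + 1 := by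
    have : 60 * j₁ ≤ k + 60 := by omega
    have : (60 * j₁ : ℝ) ≤ k + 60 := by exact_mod_cast this
    linarith
  have c2 : (k : ℝ) / 45 - 1 ≤ j₂ := by
    have : k ≤ 45 * j₂ + 45 := by omega
    have : (k : ℝ) ≤ 45 * j₂ + 45 := by exact_mod_cast this
    linarith
  obtain ⟨b1, b2⟩ := B_bounds
  have g1 := log_two_gt_d9
  have g2 := log_two_lt_d9
  -- logarithm against square root
  obtain ⟨t, ht⟩ : ∃ t, t = √(k : ℝ) := ⟨_, rfl⟩
  have htk : (k : ℝ) = t ^ 2 := by rw [ht, sq_sqrt hk0.le]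
  have ht1 : 4096 ≤ t := by
    rw [ht]
    apply le_sqrt_of_sq_le
    have : ((2 ^ 24 : ℕ) : ℝ) ≤ k := by exact_mod_cast hk
    norm_num at this ⊢
    exact this
  have hlog : log (k : ℝ) ≤ 2 * (t / 4096 + 12 * log 2 - 1) := by
    have h1 := log_le_sub_one_of_pos (x := t / 4096) (by positivity)
    rw [log_div (by positivity) (by norm_num), show (4096:ℝ) = 2 ^ 12 by norm_num, log_pow] at h1
    rw [htk, log_pow]
    push_cast at *
    linarith
  have m1 : B * j₁ ≤ B * (k / 60 + 1) := by gcongr; linarith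
  have m2 : B * (k / 45 - 1) ≤ B * j₂ := by gcongr; linarith
  have m3 : log 2 * j₁ ≤ log 2 * (k / 60 + 1) := by gcongr
  have m4 : 39 * log 2 * k ≤ B * k := by gcongr
  have m5 : 0.6931471803 * (k : ℝ) ≤ log 2 * k := by gcongr
  have main : log 2 * k / 20 ≤ 90 * log 2 + 4 * (√k * log k) + 5 * (log k + 1) := by
    rw [l4] at u7
    push_cast at *
    linarith
  have m6 : t * log k ≤ t * (2 * (t / 4096 + 12 * log 2 - 1)) := by gcongr
  rw [← ht] at main
  nlinarith

lemma step {k : ℕ} (p q : ℕ) (hq : q.Prime) (h : 3 * q < 4 * p)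
    (ih : k < 2 * p → ∃ p : ℕ, p.Prime ∧ k < 2 * p ∧ 6 * p < 4 * k) :
    k < 2 * q → ∃ p : ℕ, p.Prime ∧ k < 2 * p ∧ 6 * p < 4 * k := by
  intro hk
  by_cases hp : k < 2 * p
  · exact ih hp
  · exact ⟨q, hq, hk, by omega⟩

lemma small (k : ℕ) (h30 : 30 ≤ k) :
    k < 2 * 9578627 → ∃ p : ℕ, p.Prime ∧ k < 2 * p ∧ 6 * p < 4 * k := by
  refine step 7183987 9578627 (by norm_num) (by norm_num) ?_
  refine step 5388007 7183987 (by norm_num) (by norm_num) ?_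
  refine step 4041007 5388007 (by norm_num) (by norm_num) ?_
  refine step 3030767 4041007 (by norm_num) (by norm_num) ?_
  refine step 2273077 3030767 (by norm_num) (by norm_num) ?_
  refine step 1704809 2273077 (by norm_num) (by norm_num) ?_
  refine step 1278623 1704809 (by norm_num) (by norm_num) ?_
  refine step 958973 1278623 (by norm_num) (by norm_num) ?_
  refine step 719239 958973 (by norm_num) (by norm_num) ?_
  refine step 539449 719239 (by norm_num) (by norm_num) ?_
  refine step 404597 539449 (by norm_num) (by norm_num) ?_
  refine step 303473 404597 (by norm_num) (by norm_num) ?_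
  refine step 227611 303473 (by norm_num) (by norm_num) ?_
  refine step 170711 227611 (by norm_num) (by norm_num) ?_
  refine step 128053 170711 (by norm_num) (by norm_num) ?_
  refine step 96059 128053 (by norm_num) (by norm_num) ?_
  refine step 72047 96059 (by norm_num) (by norm_num) ?_
  refine step 54037 72047 (by norm_num) (by norm_num) ?_
  refine step 40531 54037 (by norm_num) (by norm_num) ?_
  refine step 30403 40531 (by norm_num) (by norm_num) ?_
  refine step 22817 30403 (by norm_num) (by norm_num) ?_
  refine step 17137 22817 (by norm_num) (by norm_num) ?_
  refine step 12853 17137 (by norm_num) (by norm_num) ?_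
  refine step 9661 12853 (by norm_num) (by norm_num) ?_
  refine step 7253 9661 (by norm_num) (by norm_num) ?_
  refine step 5449 7253 (by norm_num) (by norm_num) ?_
  refine step 4099 5449 (by norm_num) (by norm_num) ?_
  refine step 3079 4099 (by norm_num) (by norm_num) ?_
  refine step 2311 3079 (by norm_num) (by norm_num) ?_
  refine step 1741 2311 (by norm_num) (by norm_num) ?_
  refine step 1307 1741 (by norm_num) (by norm_num) ?_
  refine step 983 1307 (by norm_num) (by norm_num) ?_
  refine step 739 983 (by norm_num) (by norm_num) ?_
  refine step 557 739 (by norm_num) (by norm_num) ?_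
  refine step 421 557 (by norm_num) (by norm_num) ?_
  refine step 317 421 (by norm_num) (by norm_num) ?_
  refine step 241 317 (by norm_num) (by norm_num) ?_
  refine step 181 241 (by norm_num) (by norm_num) ?_
  refine step 137 181 (by norm_num) (by norm_num) ?_
  refine step 103 137 (by norm_num) (by norm_num) ?_
  refine step 79 103 (by norm_num) (by norm_num) ?_
  refine step 61 79 (by norm_num) (by norm_num) ?_
  refine step 47 61 (by norm_num) (by norm_num) ?_
  refine step 37 47 (by norm_num) (by norm_num) ?_
  refine step 29 37 (by norm_num) (by norm_num) ?_
  refine step 23 29 (by norm_num) (by norm_num) ?_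
  refine step 19 23 (by norm_num) (by norm_num) ?_
  refine step 17 19 (by norm_num) (by norm_num) ?_
  intro h
  exact ⟨17, by norm_num, h, by omega⟩

lemma all (k : ℕ) (h30 : 30 ≤ k) : ∃ p : ℕ, p.Prime ∧ k < 2 * p ∧ 6 * p < 4 * k := by
  by_cases h : 2 ^ 24 ≤ k
  · exact large k h
  · exact small k h30 (by omega)

end PrimePair

theorem exists_prime_pair_between (n : ℕ) (hn : n ≥ 15) :
    ∃ r s : ℕ, r.Prime ∧ s.Prime ∧
      2 * n < 2 * r ∧ 2 * r < 3 * n ∧ 3 * n < 2 * s ∧ 2 * s < 4 * n := by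
  obtain ⟨r, hr, h1, h2⟩ := PrimePair.all (2 * n) (by omega)
  obtain ⟨s, hs, h3, h4⟩ := PrimePair.all (3 * n) (by omega)
  exact ⟨r, s, hr, hs, by omega, by omega, by omega, by omega⟩
end

section
/- For every positive integer n there exists a prime number p in the interval [2n, 3n], i.e., with 2n ≤ p ≤ 3n. -/
open Finset Nat in
lemma aux_dvd_choose {p a k : ℕ} (hp : p.Prime) (h : p ≤ k % p + a % p) :
    p ∣ (a + k).choose k := by
  apply Nat.dvd_of_factorization_pos
  rw [Nat.factorization_choose' hp (Nat.lt_add_one _)]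
  have hle : p ≤ a + k := by
    have := Nat.mod_le k p
    have := Nat.mod_le a p
    omega
  have hl : 1 ≤ Nat.log p (a + k) := Nat.log_pos hp.one_lt hle
  apply ne_of_gt
  apply Finset.card_pos.mpr
  refine ⟨1, ?_⟩
  simp only [Finset.mem_filter, Finset.mem_Ico, pow_one]
  exact ⟨⟨le_rfl, by omega⟩, h⟩

lemma aux_mod_sub {a p : ℕ} (h1 : p ≤ a) (h2 : a < 2 * p) : a % p = a - p := by
  rw [Nat.mod_eq_sub_mod h1]
  exact Nat.mod_eq_of_lt (by omega)

lemma aux_prime_dvd {m p : ℕ} (hp : p.Prime) (h1 : m < p) (h2 : p ≤ 6 * m) :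
    p ∣ (3 * m + 3 * m).choose (3 * m) * (2 * m + m).choose m := by
  rcases lt_or_ge (3 * m) p with h | h
  · apply Dvd.dvd.mul_right
    apply aux_dvd_choose hp
    rw [Nat.mod_eq_of_lt h]; omega
  rcases lt_or_ge (2 * m) p with h' | h'
  · apply Dvd.dvd.mul_left
    apply aux_dvd_choose hp
    rw [Nat.mod_eq_of_lt h', Nat.mod_eq_of_lt h1]; omega
  rcases lt_or_ge (3 * m) (2 * p) with h'' | h''
  · apply Dvd.dvd.mul_right
    apply aux_dvd_choose hp
    rw [aux_mod_sub h h'']; omega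
  · apply Dvd.dvd.mul_left
    apply aux_dvd_choose hp
    rw [aux_mod_sub h' (by omega), Nat.mod_eq_of_lt h1]; omega

lemma aux_choose_three (m : ℕ) : (2 * m + m).choose m * 4 ^ m ≤ 27 ^ m := by
  have h := add_pow (1 : ℕ) 2 (2 * m + m)
  have h2 := Finset.single_le_sum
    (f := fun k => (1 : ℕ) ^ k * 2 ^ (2 * m + m - k) * ((2 * m + m).choose k))
    (s := Finset.range (2 * m + m + 1)) (fun _ _ => Nat.zero_le _)
    (Finset.mem_range.mpr (by omega : m < 2 * m + m + 1))
  simp only [Nat.cast_id] at h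
  rw [← h] at h2
  simp only [one_pow, one_mul, Nat.add_sub_cancel] at h2
  have e1 : (2 : ℕ) ^ (2 * m) = 4 ^ m := by rw [pow_mul]; norm_num
  have e2 : ((1 : ℕ) + 2) ^ (2 * m + m) = 27 ^ m := by
    rw [show 2 * m + m = 3 * m by ring, pow_mul]; norm_num
  rw [e1, e2] at h2
  linarith

lemma aux_primorial (m : ℕ) : primorial (6 * m) ≤ 1728 ^ m := by
  have hd : primorial (6 * m) ∣ primorial m *
      ((3 * m + 3 * m).choose (3 * m) * (2 * m + m).choose m) := by
    rw [show 6 * m = m + 5 * m by ring, primorial_add]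
    apply mul_dvd_mul_left
    apply Finset.prod_primes_dvd
    · intro p hp
      exact (Finset.mem_filter.1 hp).2.prime
    · intro p hp
      rw [Finset.mem_filter, Finset.mem_Ico] at hp
      exact aux_prime_dvd hp.2 (by omega) (by omega)
  have hpos : 0 < (3 * m + 3 * m).choose (3 * m) * (2 * m + m).choose m :=
    Nat.mul_pos (Nat.choose_pos (by omega)) (Nat.choose_pos (by omega))
  have h1 := Nat.le_of_dvd (Nat.mul_pos (primorial_pos m) hpos) hd
  have h2 : (3 * m + 3 * m).choose (3 * m) ≤ 64 ^ m := by
    refine (Nat.choose_le_two_pow _ _).trans (le_of_eq ?_)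
    rw [show 3 * m + 3 * m = 6 * m by ring, pow_mul]; norm_num
  calc primorial (6 * m) ≤ _ := h1
    _ ≤ 4 ^ m * (64 ^ m * (2 * m + m).choose m) := by
      gcongr
      exact primorial_le_four_pow m
    _ = 64 ^ m * ((2 * m + m).choose m * 4 ^ m) := by ring
    _ ≤ 64 ^ m * 27 ^ m := by gcongr; exact aux_choose_three m
    _ = 1728 ^ m := by rw [← mul_pow]; norm_num

lemma aux_choose_step (n : ℕ) :
    2 * (n + 1) * (2 * n + 1) * (3 * (n + 1)).choose (n + 1) =
      3 * (3 * n + 2) * (3 * n + 1) * (3 * n).choose n := by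
  have h1 := Nat.add_choose_mul_factorial_mul_factorial (2 * n) n
  have h2 := Nat.add_choose_mul_factorial_mul_factorial (2 * (n + 1)) (n + 1)
  rw [show 2 * n + n = 3 * n by ring] at h1
  rw [show 2 * (n + 1) + (n + 1) = 3 * (n + 1) by ring] at h2
  have s1 : (3 * n).choose (2 * n) = (3 * n).choose n :=
    Nat.choose_symm_of_eq_add (by ring)
  have s2 : (3 * (n + 1)).choose (2 * (n + 1)) = (3 * (n + 1)).choose (n + 1) :=
    Nat.choose_symm_of_eq_add (by ring)
  try rw [s1] at h1
  try rw [s2] at h2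
  have f1 : (3 * (n + 1)).factorial = (3 * n + 3) * (3 * n + 2) * (3 * n + 1) * (3 * n).factorial := by
    rw [show 3 * (n + 1) = 3 * n + 1 + 1 + 1 by ring]
    simp only [Nat.factorial_succ]; ring
  have f2 : (2 * (n + 1)).factorial = (2 * n + 2) * (2 * n + 1) * (2 * n).factorial := by
    rw [show 2 * (n + 1) = 2 * n + 1 + 1 by ring]
    simp only [Nat.factorial_succ]; ring
  rw [f1, f2, Nat.factorial_succ n, ← h1] at h2
  have hpos : 0 < (n + 1) * ((2 * n).factorial * n.factorial) := by positivity
  apply Nat.eq_of_mul_eq_mul_left hpos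
  linear_combination h2

lemma aux_lower (n : ℕ) (hn : 1 ≤ n) :
    27 ^ n ≤ 4 ^ n * ((3 * n) * (3 * n).choose n) := by
  induction n, hn using Nat.le_induction with
  | base => decide
  | succ n hn ih =>
    have hs := aux_choose_step n
    set A := (3 * (n + 1)).choose (n + 1)
    set B := (3 * n).choose n
    have hpos : 0 < 2 * n + 1 := by omega
    apply Nat.le_of_mul_le_mul_left _ hpos
    have h3 : (2 * n + 1) * (27 * (3 * n * B)) ≤ (2 * n + 1) * (4 * (3 * (n + 1) * A)) := by
      have : (2 * n + 1) * (4 * (3 * (n + 1) * A)) = 6 * (3 * (3 * n + 2) * (3 * n + 1) * B) := by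
        rw [← hs]; ring
      rw [this]
      have : (2 * n + 1) * (27 * (3 * n)) ≤ 6 * (3 * (3 * n + 2) * (3 * n + 1)) := by nlinarith
      calc _ = (2 * n + 1) * (27 * (3 * n)) * B := by ring
        _ ≤ 6 * (3 * (3 * n + 2) * (3 * n + 1)) * B := Nat.mul_le_mul_right _ this
        _ = _ := by ring
    calc (2 * n + 1) * 27 ^ (n + 1) = (2 * n + 1) * 27 * 27 ^ n := by ring
      _ ≤ (2 * n + 1) * 27 * (4 ^ n * (3 * n * B)) := Nat.mul_le_mul_left _ ih
      _ = 4 ^ n * ((2 * n + 1) * (27 * (3 * n * B))) := by ring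
      _ ≤ 4 ^ n * ((2 * n + 1) * (4 * (3 * (n + 1) * A))) := Nat.mul_le_mul_left _ h3
      _ = _ := by ring

lemma aux_fact_zero {n p : ℕ} (hp : p.Prime) (h1 : 3 * n < 2 * p) (h2 : p ≤ 2 * n) :
    ((3 * n).choose n).factorization p = 0 := by
  rw [show 3 * n = 2 * n + n by ring, Nat.factorization_choose' hp (Nat.lt_add_one _),
    Finset.card_eq_zero, Finset.filter_eq_empty_iff]
  intro i hi
  rw [Finset.mem_Ico] at hi
  obtain ⟨hi, -⟩ := hi
  rcases hi.eq_or_lt with rfl | hi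
  · rw [pow_one, aux_mod_sub h2 (by omega), Nat.mod_eq_of_lt (by omega)]
    omega
  · have hle : p ^ 2 ≤ p ^ i := Nat.pow_le_pow_right hp.pos hi
    have h4 : 2 * p ≤ p ^ 2 := by nlinarith [hp.two_le]
    have := Nat.mod_le n (p ^ i)
    have := Nat.mod_le (2 * n) (p ^ i)
    omega

lemma aux_upper (n : ℕ) (hn : 0 < n)
    (no_prime : ∀ p : ℕ, p.Prime → 2 * n ≤ p → 3 * n < p) :
    (3 * n).choose n ≤ (3 * n) ^ Nat.sqrt (3 * n) * primorial (3 * n / 2) := by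
  let S := {p ∈ Finset.range (3 * n / 2 + 1) | Nat.Prime p}
  let f x := x ^ ((3 * n).choose n).factorization x
  have e1 : ∏ x ∈ S, f x = (3 * n).choose n := by
    rw [← Nat.prod_pow_factorization_choose (3 * n) n (by omega)]
    apply Finset.prod_subset
    · intro p hp
      simp only [S, Finset.mem_filter, Finset.mem_range] at hp ⊢
      omega
    · intro p hp hpS
      simp only [S, Finset.mem_filter, Finset.mem_range, not_and] at hp hpS
      by_cases hpp : p.Prime
      · have h1 : 3 * n < 2 * p := by
          by_contra hc
          exact hpS (by omega) hpp
        have h2 : p ≤ 2 * n := by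
          by_contra hc
          have := no_prime p hpp (by omega)
          omega
        simp only [f]
        rw [aux_fact_zero hpp h1 h2, pow_zero]
      · simp only [f]
        rw [Nat.factorization_eq_zero_of_not_prime _ hpp, pow_zero]
  rw [← e1, ← Finset.prod_filter_mul_prod_filter_not S (· ≤ Nat.sqrt (3 * n))]
  apply mul_le_mul'
  · refine (Finset.prod_le_prod' fun p _ => (?_ : f p ≤ 3 * n)).trans ?_
    · exact Nat.pow_factorization_choose_le (by omega)
    have : (Finset.Icc 1 (Nat.sqrt (3 * n))).card = Nat.sqrt (3 * n) := by
      rw [Nat.card_Icc, Nat.add_sub_cancel]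
    rw [Finset.prod_const]
    refine pow_right_mono₀ (by omega) ((Finset.card_le_card fun x hx => ?_).trans this.le)
    obtain ⟨h1, h2⟩ := Finset.mem_filter.1 hx
    exact Finset.mem_Icc.mpr ⟨(Finset.mem_filter.1 h1).2.one_lt.le, h2⟩
  · refine (Finset.prod_le_prod' fun p hp => (?_ : f p ≤ p)).trans ?_
    · obtain ⟨h1, h2⟩ := Finset.mem_filter.1 hp
      refine (pow_right_mono₀ (Finset.mem_filter.1 h1).2.one_lt.le ?_).trans (pow_one p).le
      exact Nat.factorization_choose_le_one (Nat.sqrt_lt'.mp <| not_le.1 h2)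
    refine Finset.prod_le_prod_of_subset_of_one_le' (Finset.filter_subset _ _) ?_
    exact fun p hp _ => (Finset.mem_filter.1 hp).2.one_lt.le

lemma aux_real (n : ℕ) (hn : 2 ^ 22 ≤ 3 * n) :
    4 ^ n * ((3 * n) * ((3 * n) ^ Nat.sqrt (3 * n) * 1728 ^ (n / 4 + 1))) < 27 ^ n := by
  by_contra hc
  push Not at hc
  have hn0 : 0 < n := by omega
  have hR : (27 : ℝ) ^ n ≤
      4 ^ n * ((3 * n) * ((3 * n) ^ Nat.sqrt (3 * n) * 1728 ^ (n / 4 + 1))) := by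
    exact_mod_cast hc
  have hx : (2 : ℝ) ^ 22 ≤ 3 * n := by exact_mod_cast hn
  set x : ℝ := 3 * n with hxdef
  clear_value x
  have hx0 : 0 < x := lt_of_lt_of_le (by positivity) hx
  have hlog := Real.log_le_log (by positivity) hR
  rw [Real.log_mul (by positivity) (by positivity), Real.log_mul (by positivity) (by positivity),
    Real.log_mul (by positivity) (by positivity), Real.log_pow, Real.log_pow, Real.log_pow,
    Real.log_pow] at hlog
  have l27 : Real.log 27 = 3 * Real.log 3 := by
    rw [show (27 : ℝ) = 3 ^ 3 by norm_num, Real.log_pow]; norm_num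
  have l4 : Real.log 4 = 2 * Real.log 2 := by
    rw [show (4 : ℝ) = 2 ^ 2 by norm_num, Real.log_pow]; norm_num
  have l1728 : Real.log 1728 = 6 * Real.log 2 + 3 * Real.log 3 := by
    rw [show (1728 : ℝ) = 2 ^ 6 * 3 ^ 3 by norm_num, Real.log_mul (by norm_num) (by norm_num),
      Real.log_pow, Real.log_pow]; norm_num
  have hb1 : 57 * Real.log 2 ≤ 36 * Real.log 3 := by
    have := Real.log_le_log (by positivity) (show (2 : ℝ) ^ 57 ≤ 3 ^ 36 by norm_num)
    rw [Real.log_pow, Real.log_pow] at this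
    exact_mod_cast this
  have hb2 : Real.log 3 ≤ 2 * Real.log 2 := by
    rw [← l4]; exact Real.log_le_log (by norm_num) (by norm_num)
  have ha : 0 < Real.log 2 := Real.log_pos (by norm_num)
  rw [l27, l4, l1728] at hlog
  have hs : ((Nat.sqrt (3 * n) : ℕ) : ℝ) ≤ √x := by
    have := Real.nat_sqrt_le_real_sqrt (a := 3 * n)
    simpa [hxdef] using this
  have s22 : √((2 : ℝ) ^ 22) = 2048 := by
    rw [show (2 : ℝ) ^ 22 = 2048 ^ 2 by norm_num]
    exact Real.sqrt_sq (by norm_num)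
  have hsx : 2048 ≤ √x := by
    rw [← s22]; exact Real.sqrt_le_sqrt hx
  have hsq : √x * √x = x := Real.mul_self_sqrt hx0.le
  have hexp : Real.exp 2 ≤ (2 : ℝ) ^ 22 := by
    have h1 := Real.exp_one_lt_d9
    have h2 : Real.exp 2 = Real.exp 1 * Real.exp 1 := by rw [← Real.exp_add]; norm_num
    rw [h2]
    nlinarith [Real.exp_pos 1]
  have hanti := Real.log_div_sqrt_antitoneOn (Set.mem_Ici.mpr hexp)
    (Set.mem_Ici.mpr (hexp.trans hx)) hx
  simp only [s22, Real.log_pow] at hanti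
  rw [div_le_iff₀ (by linarith)] at hanti
  have hL : Real.log x ≤ 22 / 2048 * Real.log 2 * √x := by
    refine hanti.trans (le_of_eq ?_)
    push_cast; ring
  have hdiv : (((n / 4 + 1 : ℕ)) : ℝ) ≤ x / 12 + 1 := by
    push_cast
    have : ((n / 4 : ℕ) : ℝ) ≤ (n : ℝ) / 4 := Nat.cast_div_le
    rw [hxdef]; linarith
  have hLpos : 0 ≤ Real.log x := Real.log_nonneg (by linarith [show (1 : ℝ) ≤ 2 ^ 22 by norm_num])
  have hnx : (n : ℝ) = x / 3 := by rw [hxdef]; ring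
  rw [hnx] at hlog
  set a := Real.log 2
  set b := Real.log 3
  have hb0 : 0 < b := by linarith
  have t1 : ((n / 4 + 1 : ℕ) : ℝ) * (6 * a + 3 * b) ≤ (x / 12 + 1) * (6 * a + 3 * b) :=
    mul_le_mul_of_nonneg_right hdiv (by positivity)
  have t2 : ((Nat.sqrt (3 * n) : ℕ) : ℝ) * Real.log x ≤ √x * (22 / 2048 * a * √x) :=
    mul_le_mul hs hL hLpos (Real.sqrt_nonneg x)
  have t3 : √x * (22 / 2048 * a * √x) = 22 / 2048 * (a * x) := by
    rw [← hsq]; ring_nf; simp [Real.sq_sqrt, Real.sqrt_nonneg]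
  have t4 : 2048 * √x ≤ x := by
    nlinarith
  have t5 : a * (2048 * √x) ≤ a * x := mul_le_mul_of_nonneg_left t4 ha.le
  have t6 : x * (57 * a) ≤ x * (36 * b) := mul_le_mul_of_nonneg_left hb1 hx0.le
  have t7 : a * (2 : ℝ) ^ 22 ≤ a * x := mul_le_mul_of_nonneg_left hx ha.le
  norm_num at t7
  nlinarith

lemma aux_large (n : ℕ) (hn : 2 ^ 22 ≤ 3 * n) :
    ∃ p : ℕ, p.Prime ∧ 2 * n ≤ p ∧ p ≤ 3 * n := by
  by_contra! hc
  have h1 := aux_lower n (by omega)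
  have h2 := aux_upper n (by omega) hc
  have h3 : primorial (3 * n / 2) ≤ 1728 ^ (n / 4 + 1) :=
    (primorial_mono (by omega)).trans (aux_primorial (n / 4 + 1))
  have h4 := aux_real n hn
  have h5 : 4 ^ n * ((3 * n) * (3 * n).choose n) ≤
      4 ^ n * ((3 * n) * ((3 * n) ^ Nat.sqrt (3 * n) * 1728 ^ (n / 4 + 1))) := by
    gcongr
    exact h2.trans (Nat.mul_le_mul_left _ h3)
  omega

lemma aux_step {n : ℕ} (q : ℕ) {p : ℕ} (hp : p.Prime) (hpq : 2 * ((p - 1) / 3) ≤ q)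
    (H : 2 * n ≤ q → ∃ p : ℕ, p.Prime ∧ 2 * n ≤ p ∧ p ≤ 3 * n) (hn : 2 * n ≤ p) :
    ∃ p : ℕ, p.Prime ∧ 2 * n ≤ p ∧ p ≤ 3 * n := by
  by_cases h : p ≤ 3 * n
  · exact ⟨p, hp, hn, h⟩
  · exact H (by omega)

theorem exists_prime_in_Icc_two_three (n : ℕ) (hn : 0 < n) :
    ∃ p : ℕ, p.Prime ∧ 2 * n ≤ p ∧ p ≤ 3 * n := by
  rcases le_or_gt (2 ^ 22) (3 * n) with h | h
  · exact aux_large n h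
  replace h : 2 * n ≤ 2796221 := by omega
  revert h
  refine aux_step 1864151 (by norm_num) (by norm_num) ?_
  refine aux_step 1242767 (by norm_num) (by norm_num) ?_
  refine aux_step 828517 (by norm_num) (by norm_num) ?_
  refine aux_step 552353 (by norm_num) (by norm_num) ?_
  refine aux_step 368243 (by norm_num) (by norm_num) ?_
  refine aux_step 245501 (by norm_num) (by norm_num) ?_
  refine aux_step 163673 (by norm_num) (by norm_num) ?_
  refine aux_step 109121 (by norm_num) (by norm_num) ?_
  refine aux_step 72763 (by norm_num) (by norm_num) ?_
  refine aux_step 48523 (by norm_num) (by norm_num) ?_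
  refine aux_step 32353 (by norm_num) (by norm_num) ?_
  refine aux_step 21569 (by norm_num) (by norm_num) ?_
  refine aux_step 14387 (by norm_num) (by norm_num) ?_
  refine aux_step 9601 (by norm_num) (by norm_num) ?_
  refine aux_step 6421 (by norm_num) (by norm_num) ?_
  refine aux_step 4283 (by norm_num) (by norm_num) ?_
  refine aux_step 2857 (by norm_num) (by norm_num) ?_
  refine aux_step 1907 (by norm_num) (by norm_num) ?_
  refine aux_step 1277 (by norm_num) (by norm_num) ?_
  refine aux_step 853 (by norm_num) (by norm_num) ?_
  refine aux_step 569 (by norm_num) (by norm_num) ?_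
  refine aux_step 379 (by norm_num) (by norm_num) ?_
  refine aux_step 257 (by norm_num) (by norm_num) ?_
  refine aux_step 173 (by norm_num) (by norm_num) ?_
  refine aux_step 127 (by norm_num) (by norm_num) ?_
  refine aux_step 89 (by norm_num) (by norm_num) ?_
  refine aux_step 59 (by norm_num) (by norm_num) ?_
  refine aux_step 41 (by norm_num) (by norm_num) ?_
  refine aux_step 29 (by norm_num) (by norm_num) ?_
  refine aux_step 19 (by norm_num) (by norm_num) ?_
  refine aux_step 13 (by norm_num) (by norm_num) ?_
  refine aux_step 11 (by norm_num) (by norm_num) ?_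
  refine aux_step 7 (by norm_num) (by norm_num) ?_
  refine aux_step 5 (by norm_num) (by norm_num) ?_
  refine aux_step 2 (by norm_num) (by norm_num) ?_
  intro h
  exact ⟨2, Nat.prime_two, h, by omega⟩
end

section
/- For every positive integer n there exists a prime number p in the interval [3n, 4n], i.e., with 3n ≤ p ≤ 4n. -/
theorem Epat_le (y : ℕ) : y + y/30 ≤ y/2 + y/3 + y/5 + 1 := by omega

theorem Epat_ge (y : ℕ) : y/2 + y/3 + y/5 ≤ y + y/30 := by omega

theorem Epat_one (y : ℕ) (h : 1 ≤ y) (h' : y < 6) : y/2 + y/3 + y/5 + 1 = y + y/30 := by omega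

/-- Upper Stirling bound. -/
theorem log_fact_le (k : ℕ) (hk : 1 ≤ k) :
    Real.log (k.factorial : ℝ) ≤ k * Real.log k - k + 1 + Real.log k := by
  induction k, hk using Nat.le_induction with
  | base => simp
  | succ k hk ih =>
    have hk0 : (0 : ℝ) < k := by exact_mod_cast hk
    rw [Nat.factorial_succ, Nat.cast_mul, Real.log_mul (by positivity) (by positivity)]
    push_cast
    have h1 : Real.log ((k : ℝ) / (k + 1)) ≤ k / (k + 1) - 1 :=
      Real.log_le_sub_one_of_pos (by positivity)
    rw [Real.log_div (by positivity) (by positivity)] at h1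
    have h2 : ((k : ℝ) + 1) * (Real.log k - Real.log (k + 1)) ≤ (k + 1) * (k / (k + 1) - 1) :=
      mul_le_mul_of_nonneg_left h1 (by positivity)
    have h3 : ((k : ℝ) + 1) * (k / (k + 1) - 1) = -1 := by field_simp; ring
    nlinarith

theorem log_fact_ge (k : ℕ) (hk : 1 ≤ k) :
    k * Real.log k - k ≤ Real.log (k.factorial : ℝ) := by
  induction k, hk using Nat.le_induction with
  | base => simp
  | succ k hk ih =>
    have hk0 : (0 : ℝ) < k := by exact_mod_cast hk
    rw [Nat.factorial_succ, Nat.cast_mul, Real.log_mul (by positivity) (by positivity)]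
    push_cast
    have h1 : Real.log (((k : ℝ) + 1) / k) ≤ (k + 1) / k - 1 :=
      Real.log_le_sub_one_of_pos (by positivity)
    rw [Real.log_div (by positivity) (by positivity)] at h1
    have h2 : (k : ℝ) * (Real.log (k + 1) - Real.log k) ≤ k * ((k + 1) / k - 1) :=
      mul_le_mul_of_nonneg_left h1 (by positivity)
    have h3 : (k : ℝ) * ((k + 1) / k - 1) = 1 := by field_simp; ring
    nlinarith

theorem log_fact_real (k : ℕ) (hk : 1 ≤ k) (y : ℝ) (h1 : (k : ℝ) ≤ y) (h2 : y ≤ k + 1) :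
    y * Real.log y - y - Real.log y ≤ Real.log (k.factorial : ℝ) ∧
    Real.log (k.factorial : ℝ) ≤ y * Real.log y - y + Real.log y + 1 := by
  have hk1 : (1 : ℝ) ≤ k := by exact_mod_cast hk
  have hy : 0 < y := by linarith
  have hly : 0 ≤ Real.log y := Real.log_nonneg (by linarith)
  have hlk : 0 ≤ Real.log k := Real.log_nonneg hk1
  have hlky : Real.log k ≤ Real.log y := Real.log_le_log (by linarith) h1
  constructor
  · have h := log_fact_ge k hk
    have a : Real.log (y / k) ≤ y / k - 1 := Real.log_le_sub_one_of_pos (by positivity)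
    rw [Real.log_div (by positivity) (by positivity)] at a
    have b : (k : ℝ) * (Real.log y - Real.log k) ≤ k * (y / k - 1) :=
      mul_le_mul_of_nonneg_left a (by positivity)
    have c : (k : ℝ) * (y / k - 1) = y - k := by field_simp
    nlinarith [mul_nonneg (sub_nonneg.2 h2) hly]
  · have h := log_fact_le k hk
    have a : Real.log (k / y) ≤ k / y - 1 := Real.log_le_sub_one_of_pos (by positivity)
    rw [Real.log_div (by positivity) (by positivity)] at a
    have b : y * (Real.log k - Real.log y) ≤ y * (k / y - 1) :=
      mul_le_mul_of_nonneg_left a (by positivity)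
    have c : y * (k / y - 1) = k - y := by field_simp
    nlinarith [mul_nonneg (sub_nonneg.2 h1) hlk]

theorem log_fact_div (N m : ℕ) (hm : 1 ≤ m) (hN : m ≤ N) :
    (N / m : ℝ) * (Real.log N - Real.log m) - N / m - Real.log N
      ≤ Real.log ((N / m).factorial : ℝ) ∧
    Real.log ((N / m).factorial : ℝ) ≤
      (N / m : ℝ) * (Real.log N - Real.log m) - N / m + Real.log N + 1 := by
  have hm0 : (1 : ℝ) ≤ m := by exact_mod_cast hm
  have hN0 : (1 : ℝ) ≤ N := by exact_mod_cast hm.trans hN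
  have h := log_fact_real (N / m) (Nat.div_pos hN hm) (N / m : ℝ) Nat.cast_div_le
    (by
      rw [div_le_iff₀ (by linarith)]
      have : N ≤ (N / m + 1) * m := by
        have := Nat.lt_mul_div_succ N (show 0 < m from hm)
        rw [mul_comm]; exact this.le
      exact_mod_cast this)
  rw [Real.log_div (by positivity) (by positivity)] at h
  have := Real.log_nonneg hm0
  constructor <;> linarith [h.1, h.2]

/-- Chebyshev combination of log-factorials. -/
noncomputable def chebS (N : ℕ) : ℝ :=
  Real.log (N.factorial : ℝ) - Real.log ((N / 2).factorial : ℝ) - Real.log ((N / 3).factorial : ℝ)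
    - Real.log ((N / 5).factorial : ℝ) + Real.log ((N / 30).factorial : ℝ)

noncomputable def chebA : ℝ :=
  14 / 30 * Real.log 2 + 9 / 30 * Real.log 3 + 5 / 30 * Real.log 5

theorem chebS_bounds (N : ℕ) (hN : 30 ≤ N) :
    chebA * N - 5 * Real.log N - 5 ≤ chebS N ∧ chebS N ≤ chebA * N + 5 * Real.log N + 5 := by
  have h1 := log_fact_div N 1 (by norm_num) (by omega)
  have h2 := log_fact_div N 2 (by norm_num) (by omega)
  have h3 := log_fact_div N 3 (by norm_num) (by omega)
  have h5 := log_fact_div N 5 (by norm_num) (by omega)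
  have h30 := log_fact_div N 30 (by norm_num) (by omega)
  have e : Real.log 30 = Real.log 2 + Real.log 3 + Real.log 5 := by
    rw [← Real.log_mul (by norm_num) (by norm_num), ← Real.log_mul (by norm_num) (by norm_num)]
    norm_num
  simp only [Nat.cast_ofNat, Nat.cast_one, Real.log_one, Nat.div_one] at h1 h2 h3 h5 h30
  rw [e] at h30
  unfold chebS chebA
  obtain ⟨a1, b1⟩ := h1
  obtain ⟨a2, b2⟩ := h2
  obtain ⟨a3, b3⟩ := h3
  obtain ⟨a5, b5⟩ := h5
  obtain ⟨a30, b30⟩ := h30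
  constructor
  · ring_nf at *
    linarith
  · ring_nf at *
    linarith

open ArithmeticFunction in
theorem log_fact_eq (N : ℕ) : Real.log (N.factorial : ℝ) =
    ∑ n ∈ Finset.Ioc 0 N, vonMangoldt n * ((N / n : ℕ) : ℝ) := by
  rw [← ArithmeticFunction.sum_Ioc_mul_zeta_eq_sum, vonMangoldt_mul_zeta]
  induction N with
  | zero => simp
  | succ k ih =>
    rw [Nat.factorial_succ, Nat.cast_mul, Real.log_mul (by positivity) (by positivity), ih,
      Finset.sum_Ioc_succ_top (by omega)]
    simp [add_comm, ArithmeticFunction.log_apply]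

open ArithmeticFunction in
theorem log_fact_div_eq (N m : ℕ) : Real.log ((N / m).factorial : ℝ) =
    ∑ n ∈ Finset.Ioc 0 N, vonMangoldt n * ((N / n / m : ℕ) : ℝ) := by
  rw [log_fact_eq]
  have hs : Finset.Ioc 0 (N / m) ⊆ Finset.Ioc 0 N :=
    Finset.Ioc_subset_Ioc_right (Nat.div_le_self N m)
  rw [← Finset.sum_subset hs]
  · refine Finset.sum_congr rfl fun n _ => ?_
    rw [Nat.div_div_eq_div_mul, Nat.div_div_eq_div_mul, mul_comm m n]
  · intro n hn hn'
    simp only [Finset.mem_Ioc, not_and, not_le] at hn hn'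
    have : N / n / m = 0 := by
      rw [Nat.div_div_eq_div_mul, mul_comm, ← Nat.div_div_eq_div_mul]
      exact Nat.div_eq_of_lt (hn' hn.1)
    rw [this]; simp

open ArithmeticFunction in
theorem chebS_eq (N : ℕ) : chebS N = ∑ n ∈ Finset.Ioc 0 N, vonMangoldt n *
    (((N / n : ℕ) : ℝ) - ((N / n / 2 : ℕ) : ℝ) - ((N / n / 3 : ℕ) : ℝ)
      - ((N / n / 5 : ℕ) : ℝ) + ((N / n / 30 : ℕ) : ℝ)) := by
  unfold chebS
  rw [log_fact_eq N, log_fact_div_eq N 2, log_fact_div_eq N 3, log_fact_div_eq N 5,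
    log_fact_div_eq N 30]
  simp only [← Finset.sum_sub_distrib, ← Finset.sum_add_distrib]
  refine Finset.sum_congr rfl fun n _ => ?_
  ring

open ArithmeticFunction in
theorem chebS_le_psi (N : ℕ) : chebS N ≤ Chebyshev.psi N := by
  rw [chebS_eq, Chebyshev.psi, Nat.floor_natCast]
  refine Finset.sum_le_sum fun n _ => ?_
  have h : (((N / n + N / n / 30 : ℕ)) : ℝ) ≤ ((N / n / 2 + N / n / 3 + N / n / 5 + 1 : ℕ) : ℝ) :=
    Nat.cast_le.2 (Epat_le (N / n))
  push_cast at h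
  have h0 : 0 ≤ vonMangoldt n := vonMangoldt_nonneg
  refine mul_le_of_le_one_right h0 ?_
  linarith

open ArithmeticFunction in
theorem psi_le_chebS (N : ℕ) : Chebyshev.psi N ≤ Chebyshev.psi (N / 6 : ℕ) + chebS N := by
  rw [chebS_eq, Chebyshev.psi, Chebyshev.psi, Nat.floor_natCast, Nat.floor_natCast]
  have hs : Finset.Ioc 0 (N / 6) ⊆ Finset.Ioc 0 N :=
    Finset.Ioc_subset_Ioc_right (Nat.div_le_self N 6)
  rw [← Finset.sum_sdiff hs, add_comm]
  gcongr
  rw [← Finset.sum_sdiff hs]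
  have key : ∀ n, (0 : ℝ) ≤ (((N / n : ℕ) : ℝ) - ((N / n / 2 : ℕ) : ℝ) - ((N / n / 3 : ℕ) : ℝ)
      - ((N / n / 5 : ℕ) : ℝ) + ((N / n / 30 : ℕ) : ℝ)) := by
    intro n
    have h : ((N / n / 2 + N / n / 3 + N / n / 5 : ℕ) : ℝ) ≤ (((N / n + N / n / 30 : ℕ)) : ℝ) :=
      Nat.cast_le.2 (Epat_ge (N / n))
    push_cast at h
    linarith
  have hnn : 0 ≤ ∑ n ∈ Finset.Ioc 0 (N / 6), vonMangoldt n *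
    (((N / n : ℕ) : ℝ) - ((N / n / 2 : ℕ) : ℝ) - ((N / n / 3 : ℕ) : ℝ)
      - ((N / n / 5 : ℕ) : ℝ) + ((N / n / 30 : ℕ) : ℝ)) :=
    Finset.sum_nonneg fun n _ => mul_nonneg vonMangoldt_nonneg (key n)
  refine le_trans (le_of_eq ?_) (le_add_of_nonneg_right hnn)
  refine Finset.sum_congr rfl fun n hn => ?_
  simp only [Finset.mem_sdiff, Finset.mem_Ioc, not_and, not_le] at hn
  obtain ⟨⟨hn0, hnN⟩, hn6⟩ := hn
  have hlt : N / n < 6 := by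
    rw [Nat.div_lt_iff_lt_mul hn0]
    have := hn6 hn0
    omega
  have h : ((N / n / 2 + N / n / 3 + N / n / 5 + 1 : ℕ) : ℝ) = (((N / n + N / n / 30 : ℕ)) : ℝ) :=
    congrArg _ (Epat_one (N / n) (Nat.div_pos hnN hn0) hlt)
  push_cast at h
  have h1 : (((N / n : ℕ) : ℝ) - ((N / n / 2 : ℕ) : ℝ) - ((N / n / 3 : ℕ) : ℝ)
      - ((N / n / 5 : ℕ) : ℝ) + ((N / n / 30 : ℕ) : ℝ)) = 1 := by linarith
  rw [h1, mul_one]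

theorem chebA_gt : 0.866 < chebA := by
  have h2 := Real.log_two_gt_d9
  have h3 := Real.log_three_gt_d9
  have h5 : 2 * Real.log 2 ≤ Real.log 5 := by
    have : Real.log 4 = 2 * Real.log 2 := by
      rw [show (4 : ℝ) = 2 ^ 2 by norm_num, Real.log_pow]; norm_num
    rw [← this]
    exact Real.log_le_log (by norm_num) (by norm_num)
  unfold chebA
  norm_num at *
  linarith

theorem psi_step (M N : ℕ) (hM : 30 ≤ M) (hMN : M ≤ N) :
    Chebyshev.psi M ≤ Chebyshev.psi (M / 6 : ℕ) + chebA * M + 5 * Real.log N + 5 := by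
  have h1 := psi_le_chebS M
  have h2 := (chebS_bounds M hM).2
  have h3 : Real.log M ≤ Real.log N :=
    Real.log_le_log (by exact_mod_cast (by omega : 0 < M)) (by exact_mod_cast hMN)
  linarith

theorem psi_upper (N : ℕ) (hN : 6000 ≤ N) :
    Chebyshev.psi N ≤ (chebA * (43 / 36) + 0.026) * N + 15 * Real.log N + 15 := by
  have h1 := psi_step N N (by omega) le_rfl
  have h2 := psi_step (N / 6) N (by omega) (by omega)
  have h3 := psi_step (N / 6 / 6) N (by omega) (by omega)
  have h4 := Chebyshev.psi_le_const_mul_self (x := ((N / 6 / 6 / 6 : ℕ) : ℝ)) (by positivity)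
  have hA := chebA_gt
  have c1 : ((N / 6 : ℕ) : ℝ) ≤ (N : ℝ) / 6 := by exact_mod_cast Nat.cast_div_le
  have c2 : ((N / 6 / 6 : ℕ) : ℝ) ≤ ((N / 6 : ℕ) : ℝ) / 6 := by exact_mod_cast Nat.cast_div_le
  have c3 : ((N / 6 / 6 / 6 : ℕ) : ℝ) ≤ ((N / 6 / 6 : ℕ) : ℝ) / 6 := by
    exact_mod_cast Nat.cast_div_le
  have h4' : Real.log 4 = 2 * Real.log 2 := by
    rw [show (4 : ℝ) = 2 ^ 2 by norm_num, Real.log_pow]; norm_num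
  have hl := Real.log_two_lt_d9
  have d1 : chebA * ((N / 6 : ℕ) : ℝ) ≤ chebA * ((N : ℝ) / 6) :=
    mul_le_mul_of_nonneg_left c1 (by norm_num at hA; linarith)
  have d2 : chebA * ((N / 6 / 6 : ℕ) : ℝ) ≤ chebA * ((N : ℝ) / 36) :=
    mul_le_mul_of_nonneg_left (by linarith) (by norm_num at hA; linarith)
  have d3 : (Real.log 4 + 4) * ((N / 6 / 6 / 6 : ℕ) : ℝ) ≤ 5.4 * ((N : ℝ) / 216) := by
    refine mul_le_mul ?_ (by linarith) (by positivity) (by norm_num)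
    rw [h4']; norm_num at *; linarith
  have hN0 : (0 : ℝ) ≤ N := by positivity
  norm_num at *
  linarith

theorem theta_eq_of_no_prime (a b : ℕ) (hab : a ≤ b) (h : ∀ p, p.Prime → a ≤ p → ¬ p ≤ b) :
    Chebyshev.theta a = Chebyshev.theta b := by
  unfold Chebyshev.theta
  rw [Nat.floor_natCast, Nat.floor_natCast]
  congr 1
  ext p
  simp only [Finset.mem_filter, Finset.mem_Ioc]
  constructor
  · rintro ⟨⟨h1, h2⟩, h3⟩
    exact ⟨⟨h1, h2.trans hab⟩, h3⟩
  · rintro ⟨⟨h1, h2⟩, h3⟩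
    refine ⟨⟨h1, ?_⟩, h3⟩
    by_contra hc
    exact h p h3 (by omega) h2

theorem large_case (n : ℕ) (hn : 250000 ≤ n) :
    ∃ p : ℕ, p.Prime ∧ 3 * n ≤ p ∧ p ≤ 4 * n := by
  by_contra hcon
  push Not at hcon
  have heq := theta_eq_of_no_prime (3 * n) (4 * n) (by omega)
    (fun p hp h => not_le.2 (hcon p hp h))
  have h3 := psi_upper (3 * n) (by omega)
  have h4 := chebS_le_psi (4 * n)
  have h4' := (chebS_bounds (4 * n) (by omega)).1
  have hnR : (250000 : ℝ) ≤ n := by exact_mod_cast hn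
  have ht3 := Chebyshev.theta_le_psi ((3 * n : ℕ) : ℝ)
  have ht4 := Chebyshev.psi_sub_theta_le (x := ((4 * n : ℕ) : ℝ)) (by push_cast; linarith)
  have hlog : Real.log ((3 * n : ℕ) : ℝ) ≤ Real.log ((4 * n : ℕ) : ℝ) :=
    Real.log_le_log (by push_cast; linarith) (by push_cast; linarith)
  have hA := chebA_gt
  set s : ℝ := √((4 * n : ℕ) : ℝ) with hs
  have hsq : s ^ 2 = 4 * n := by
    rw [hs, Real.sq_sqrt (by positivity)]; push_cast; ring
  have hs1000 : 1000 ≤ s := by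
    rw [hs]; apply Real.le_sqrt_of_sq_le; push_cast; linarith
  have hL : Real.log ((4 * n : ℕ) : ℝ) = 2 * Real.log s := by
    rw [hs, Real.log_sqrt (by positivity)]; ring
  have hls : Real.log s ≤ 5.94 + s / 1000 := by
    have a : Real.log (s / 1000) ≤ s / 1000 - 1 := Real.log_le_sub_one_of_pos (by linarith)
    rw [Real.log_div (by linarith) (by norm_num)] at a
    have b : Real.log 1000 ≤ 10 * Real.log 2 := by
      rw [show (10 : ℝ) * Real.log 2 = Real.log (2 ^ 10) by rw [Real.log_pow]; norm_num]
      exact Real.log_le_log (by norm_num) (by norm_num)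
    have c := Real.log_two_lt_d9
    norm_num at *
    linarith
  have hmul : s * Real.log s ≤ s * (5.94 + s / 1000) :=
    mul_le_mul_of_nonneg_left hls (by linarith)
  rw [hL] at h4' ht4 hlog
  have hAn : 0.866 * (n : ℝ) ≤ chebA * n := mul_le_mul_of_nonneg_right hA.le (by linarith)
  have hs2 : 1000 * s ≤ s ^ 2 := by nlinarith
  push_cast at *
  norm_num at *
  nlinarith

theorem small_case (n : ℕ) (hn : 0 < n) (h : n < 250000) :
    ∃ p : ℕ, p.Prime ∧ 3 * n ≤ p ∧ p ≤ 4 * n := by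
  by_cases h3 : n ≤ 1
  · exact ⟨3, by norm_num, by omega, by omega⟩
  by_cases h7 : n ≤ 2
  · exact ⟨7, by norm_num, by omega, by omega⟩
  by_cases h11 : n ≤ 3
  · exact ⟨11, by norm_num, by omega, by omega⟩
  by_cases h13 : n ≤ 4
  · exact ⟨13, by norm_num, by omega, by omega⟩
  by_cases h19 : n ≤ 6
  · exact ⟨19, by norm_num, by omega, by omega⟩
  by_cases h23 : n ≤ 7
  · exact ⟨23, by norm_num, by omega, by omega⟩
  by_cases h31 : n ≤ 10
  · exact ⟨31, by norm_num, by omega, by omega⟩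
  by_cases h43 : n ≤ 14
  · exact ⟨43, by norm_num, by omega, by omega⟩
  by_cases h59 : n ≤ 19
  · exact ⟨59, by norm_num, by omega, by omega⟩
  by_cases h79 : n ≤ 26
  · exact ⟨79, by norm_num, by omega, by omega⟩
  by_cases h107 : n ≤ 35
  · exact ⟨107, by norm_num, by omega, by omega⟩
  by_cases h139 : n ≤ 46
  · exact ⟨139, by norm_num, by omega, by omega⟩
  by_cases h181 : n ≤ 60
  · exact ⟨181, by norm_num, by omega, by omega⟩
  by_cases h241 : n ≤ 80
  · exact ⟨241, by norm_num, by omega, by omega⟩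
  by_cases h317 : n ≤ 105
  · exact ⟨317, by norm_num, by omega, by omega⟩
  by_cases h421 : n ≤ 140
  · exact ⟨421, by norm_num, by omega, by omega⟩
  by_cases h563 : n ≤ 187
  · exact ⟨563, by norm_num, by omega, by omega⟩
  by_cases h751 : n ≤ 250
  · exact ⟨751, by norm_num, by omega, by omega⟩
  by_cases h997 : n ≤ 332
  · exact ⟨997, by norm_num, by omega, by omega⟩
  by_cases h1327 : n ≤ 442
  · exact ⟨1327, by norm_num, by omega, by omega⟩
  by_cases h1759 : n ≤ 586
  · exact ⟨1759, by norm_num, by omega, by omega⟩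
  by_cases h2347 : n ≤ 782
  · exact ⟨2347, by norm_num, by omega, by omega⟩
  by_cases h3121 : n ≤ 1040
  · exact ⟨3121, by norm_num, by omega, by omega⟩
  by_cases h4159 : n ≤ 1386
  · exact ⟨4159, by norm_num, by omega, by omega⟩
  by_cases h5531 : n ≤ 1843
  · exact ⟨5531, by norm_num, by omega, by omega⟩
  by_cases h7369 : n ≤ 2456
  · exact ⟨7369, by norm_num, by omega, by omega⟩
  by_cases h9817 : n ≤ 3272
  · exact ⟨9817, by norm_num, by omega, by omega⟩
  by_cases h13063 : n ≤ 4354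
  · exact ⟨13063, by norm_num, by omega, by omega⟩
  by_cases h17419 : n ≤ 5806
  · exact ⟨17419, by norm_num, by omega, by omega⟩
  by_cases h23227 : n ≤ 7742
  · exact ⟨23227, by norm_num, by omega, by omega⟩
  by_cases h30971 : n ≤ 10323
  · exact ⟨30971, by norm_num, by omega, by omega⟩
  by_cases h41281 : n ≤ 13760
  · exact ⟨41281, by norm_num, by omega, by omega⟩
  by_cases h55021 : n ≤ 18340
  · exact ⟨55021, by norm_num, by omega, by omega⟩
  by_cases h73363 : n ≤ 24454
  · exact ⟨73363, by norm_num, by omega, by omega⟩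
  by_cases h97813 : n ≤ 32604
  · exact ⟨97813, by norm_num, by omega, by omega⟩
  by_cases h130411 : n ≤ 43470
  · exact ⟨130411, by norm_num, by omega, by omega⟩
  by_cases h173867 : n ≤ 57955
  · exact ⟨173867, by norm_num, by omega, by omega⟩
  by_cases h231823 : n ≤ 77274
  · exact ⟨231823, by norm_num, by omega, by omega⟩
  by_cases h309091 : n ≤ 103030
  · exact ⟨309091, by norm_num, by omega, by omega⟩
  by_cases h412123 : n ≤ 137374
  · exact ⟨412123, by norm_num, by omega, by omega⟩
  by_cases h549481 : n ≤ 183160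
  · exact ⟨549481, by norm_num, by omega, by omega⟩
  by_cases h732631 : n ≤ 244210
  · exact ⟨732631, by norm_num, by omega, by omega⟩
  by_cases h976823 : n ≤ 325607
  · exact ⟨976823, by norm_num, by omega, by omega⟩
  omega

theorem exists_prime_in_Icc_three_four (n : ℕ) (hn : 0 < n) :
    ∃ p : ℕ, p.Prime ∧ 3 * n ≤ p ∧ p ≤ 4 * n := by
  rcases lt_or_ge n 250000 with h | h
  · exact small_case n hn h
  · exact large_case n h
end
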